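/- Consider a constrained strategic game Γ satisfying Assumptions 1 and 3 that is a constrained potential game with potential function φ, and let the players follow PHPIP with exploration rate ε ∈ (0,1/2] and κ ∈ (0,1/2]. Then for every probability p < 1 there exists ε* > 0 such that for every ε ∈ (0, ε*] there exists K ∈ ℕ with Prob[ a(k) ∈ argmax_{a ∈ A} φ(a) ] > p for all k ≥ K, where a(k) denotes the current joint action (the second component of the state of the chain {P^ε}) at round k, from any initial state. -/

import Mathlib

open Filter Topology Set

attribute [local instance] Classical.propDecidable

section PHPIP

variable {ι : Type*} [Fintype ι] [DecidableEq ι] {A : ι → Type*} [∀ i, Fintype (A i)]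

/-- Assumption 1 on the constraint maps. -/
def Assumption1 (C : ∀ i, A i → Finset (A i)) : Prop :=
  (∀ (i : ι) (a b : A i), b ∈ C i a ↔ a ∈ C i b) ∧
  (∀ (i : ι) (a b : A i), ∃ (nf : ℕ) (f : ℕ → A i), f 0 = a ∧ f nf = b ∧
      ∀ k < nf, f (k + 1) ∈ C i (f k)) ∧
  (∀ (i : ι) (a : A i), 3 ≤ (C i a).card)

/-- Assumption 3: unilateral constrained deviations change the utility by less than 1/2. -/
def Assumption3 (U : ι → (∀ i, A i) → ℝ) (C : ∀ i, A i → Finset (A i)) : Prop :=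
  ∀ (i : ι) (a : ∀ j, A j) (b : A i), b ∈ C i (a i) →
    U i (Function.update a i b) - U i a < 1 / 2

/-- Γ is a constrained potential game with potential function φ. -/
def IsPotentialGame (U : ι → (∀ i, A i) → ℝ) (C : ∀ i, A i → Finset (A i))
    (φ : (∀ i, A i) → ℝ) : Prop :=
  ∀ (i : ι) (a : ∀ j, A j) (b : A i), b ∈ C i (a i) →
    U i (Function.update a i b) - U i a = φ (Function.update a i b) - φ a

/-- Probability that, from state `(a0, a1)`, player `i` selects the action `x`
under the PHPIP selection rule with exploration rate `ε` and parameter `κ`. -/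
noncomputable def selProb (κ : ℝ) (U : ι → (∀ i, A i) → ℝ)
    (C : ∀ i, A i → Finset (A i)) (ε : ℝ) (a0 a1 : ∀ i, A i) (i : ι) (x : A i) : ℝ :=
  if U i a0 ≤ U i a1 then
    (if x = a1 i then 1 - ε else 0) +
      (if x ∈ (C i (a1 i)).erase (a1 i) then
        ε / ((C i (a1 i)).erase (a1 i)).card else 0)
  else
    (if x = a1 i then (1 - ε) * (κ * ε ^ (U i a0 - U i a1)) else 0) +
      (if x = a0 i then (1 - ε) * (1 - κ * ε ^ (U i a0 - U i a1)) else 0) +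
      (if x ∈ ((C i (a1 i)).erase (a1 i)).erase (a0 i) then
        ε / (((C i (a1 i)).erase (a1 i)).erase (a0 i)).card else 0)

/-- One-step transition probability of the Markov chain `{P^ε}` induced by PHPIP
on pairs of joint actions. -/
noncomputable def phTrans (κ : ℝ) (U : ι → (∀ i, A i) → ℝ)
    (C : ∀ i, A i → Finset (A i)) (ε : ℝ)
    (z1 z2 : (∀ i, A i) × (∀ i, A i)) : ℝ :=
  if z2.1 = z1.2 then ∏ i, selProb κ U C ε z1.1 z1.2 i (z2.2 i) else 0

/-- The state space B. -/
def memB (C : ∀ i, A i → Finset (A i)) (z : (∀ i, A i) × (∀ i, A i)) : Prop :=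
  ∀ i, z.2 i ∈ C i (z.1 i)

/-- k-step transition probabilities of the homogeneous chain `{P^ε}`. -/
noncomputable def phTransPow (κ : ℝ) (U : ι → (∀ i, A i) → ℝ)
    (C : ∀ i, A i → Finset (A i)) (ε : ℝ) :
    ℕ → (∀ i, A i) × (∀ i, A i) → (∀ i, A i) × (∀ i, A i) → ℝ
  | 0, z, z' => if z = z' then 1 else 0
  | k + 1, z, z' => ∑ w : (∀ i, A i) × (∀ i, A i),
      phTrans κ U C ε z w * phTransPow κ U C ε k w z'

/-- Probability of a path (sequence of states) of the chain `{P^ε}`. -/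
noncomputable def pathProb (κ : ℝ) (U : ι → (∀ i, A i) → ℝ)
    (C : ∀ i, A i → Finset (A i)) (ε : ℝ) :
    List ((∀ i, A i) × (∀ i, A i)) → ℝ
  | [] => 1
  | [_] => 1
  | z :: z' :: rest => phTrans κ U C ε z z' * pathProb κ U C ε (z' :: rest)

/-- A transition is feasible if it has positive probability for some ε ∈ (0,1/2]. -/
def Feasible (κ : ℝ) (U : ι → (∀ i, A i) → ℝ) (C : ∀ i, A i → Finset (A i))
    (z z' : (∀ i, A i) × (∀ i, A i)) : Prop :=
  ∃ ε : ℝ, 0 < ε ∧ ε ≤ 1 / 2 ∧ 0 < phTrans κ U C ε z z'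

/-- `l` is a (feasible) path of the chain from `z1` to `z2`. -/
def IsPath (κ : ℝ) (U : ι → (∀ i, A i) → ℝ) (C : ∀ i, A i → Finset (A i))
    (z1 z2 : (∀ i, A i) × (∀ i, A i)) (l : List ((∀ i, A i) × (∀ i, A i))) : Prop :=
  l.head? = some z1 ∧ l.getLast? = some z2 ∧ l.Chain' (Feasible κ U C)

/-- `r` is the resistance of the path `l`:  `lim_{ε→0+} P^ε(l)/ε^r ∈ (0,∞)`. -/
def IsPathRes (κ : ℝ) (U : ι → (∀ i, A i) → ℝ) (C : ∀ i, A i → Finset (A i))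
    (l : List ((∀ i, A i) × (∀ i, A i))) (r : ℝ) : Prop :=
  ∃ L : ℝ, 0 < L ∧
    Tendsto (fun ε : ℝ => pathProb κ U C ε l / ε ^ r) (𝓝[>] (0 : ℝ)) (𝓝 L)

/-- `(a, b)` (as diagonal states `((a,a),(b,b))`) is a pair in `E_s`:
exactly one player deviates and the deviation is feasible. -/
def EsPair (C : ∀ i, A i → Finset (A i)) (a b : ∀ i, A i) : Prop :=
  (∃! i, a i ≠ b i) ∧ ∀ i, a i ≠ b i → b i ∈ C i (a i)

/-- The path (list of states) of the M-straight-route through the given diagonal nodes. -/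
def msrPath : List (∀ i, A i) → List ((∀ i, A i) × (∀ i, A i))
  | [] => []
  | [a] => [(a, a)]
  | a :: b :: rest => (a, a) :: (a, b) :: msrPath (b :: rest)

/-- Weight of the edge of the graph `G_R` from `z` to `z'`: the minimal resistance
among all paths of `{P^ε}` from `z` to `z'`. -/
noncomputable def edgeWeight (κ : ℝ) (U : ι → (∀ i, A i) → ℝ)
    (C : ∀ i, A i → Finset (A i)) (z z' : (∀ i, A i) × (∀ i, A i)) : ℝ :=
  sInf {r : ℝ | ∃ l, IsPath κ U C z z' l ∧ IsPathRes κ U C l r}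

/-- `y` is reachable from `x` in at most `d` constraint-feasible steps. -/
def ReachIn (C : ∀ i, A i → Finset (A i)) (i : ι) : ℕ → A i → A i → Prop
  | 0, x, y => x = y
  | d + 1, x, y => ReachIn C i d x y ∨ ∃ w, ReachIn C i d x w ∧ y ∈ C i w

/-- Inhomogeneous products: `transProd κ U C εs k0 m` is the transition matrix
`P(k0, k0 + m) = ∏_{k'=k0}^{k0+m-1} P_{k'}` of the PIPIP chain with exploration
rates `εs`. -/
noncomputable def transProd (κ : ℝ) (U : ι → (∀ i, A i) → ℝ)
    (C : ∀ i, A i → Finset (A i)) (εs : ℕ → ℝ) (k0 : ℕ) :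
    ℕ → (∀ i, A i) × (∀ i, A i) → (∀ i, A i) × (∀ i, A i) → ℝ
  | 0, z, z' => if z = z' then 1 else 0
  | m + 1, z, z' => ∑ w : (∀ i, A i) × (∀ i, A i),
      transProd κ U C εs k0 m z w * phTrans κ U C (εs (k0 + m)) w z'

/-- The PIPIP exploration rate `ε(k) = k^{-1/(n(D+1))}`. -/
noncomputable def pipipRate (n D : ℕ) (k : ℕ) : ℝ :=
  (k : ℝ) ^ (-(1 : ℝ) / ((n : ℝ) * ((D : ℝ) + 1)))

/-- Accessibility along the unperturbed chain `{P^0}`. -/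
def Accessible0 (κ : ℝ) (U : ι → (∀ i, A i) → ℝ) (C : ∀ i, A i → Finset (A i))
    (z z' : (∀ i, A i) × (∀ i, A i)) : Prop :=
  ∃ k : ℕ, 0 < phTransPow κ U C 0 k z z'

/-- A recurrent communication class of the unperturbed chain `{P^0}`. -/
def IsRecClass (κ : ℝ) (U : ι → (∀ i, A i) → ℝ) (C : ∀ i, A i → Finset (A i))
    (H : Set ((∀ i, A i) × (∀ i, A i))) : Prop :=
  H.Nonempty ∧ (∀ z ∈ H, ∀ z' ∈ H, Accessible0 κ U C z z') ∧
    (∀ z ∈ H, ∀ z', Accessible0 κ U C z z' → z' ∈ H)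

end PHPIP

/-- The powers of a row-stochastic matrix which charges some column `s` from everywhere, with a
loop at `s`, converge to a matrix whose rows all equal a stationary distribution. -/
theorem exists_stationary_tendsto_pow {Z : Type*} [Fintype Z] [DecidableEq Z] (P : Matrix Z Z ℝ)
    (hP : P ∈ Matrix.rowStochastic ℝ Z) (s : Z) (hreach : ∀ z, ∃ k, 0 < (P ^ k) z s)
    (hloop : 0 < P s s) :
    ∃ π : Z → ℝ, (∀ z, 0 ≤ π z) ∧ ∑ z, π z = 1 ∧ (∀ w, ∑ z, π z * P z w = π w) ∧
      ∀ z w, Tendsto (fun k => (P ^ k) z w) atTop (𝓝 (π w)) := by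
  have hpow : ∀ k, P ^ k ∈ Matrix.rowStochastic ℝ Z := fun k => pow_mem hP k
  have hnn : ∀ k z w, 0 ≤ (P ^ k) z w := fun k z w =>
    Matrix.nonneg_of_mem_rowStochastic (hpow k)
  have hsum : ∀ k z, ∑ w, (P ^ k) z w = 1 := fun k z =>
    Matrix.sum_row_of_mem_rowStochastic (hpow k) z
  have hmono : ∀ z k m, 0 < (P ^ k) z s → 0 < (P ^ (k + m)) z s := by
    intro z k m hk
    induction m with
    | zero => exact hk
    | succ m ih =>
      rw [← add_assoc, pow_succ, Matrix.mul_apply]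
      refine lt_of_lt_of_le (mul_pos ih hloop)
        (Finset.single_le_sum (f := fun v => (P ^ (k + m)) z v * P v s) ?_ (Finset.mem_univ s))
      intro v _
      have := hnn 1 v s
      rw [pow_one] at this
      exact mul_nonneg (hnn _ _ _) this
  obtain ⟨T, hT⟩ : ∃ T, ∀ z, 0 < (P ^ T) z s := by
    choose k hk using hreach
    refine ⟨∑ z, k z, fun z => ?_⟩
    have : k z ≤ ∑ z, k z := Finset.single_le_sum (fun _ _ => Nat.zero_le _) (Finset.mem_univ z)
    obtain ⟨m, hm⟩ := Nat.exists_eq_add_of_le this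
    rw [hm]
    exact hmono z _ _ (hk z)
  obtain ⟨δ, hδ0, hδ1, hδ⟩ : ∃ δ : ℝ, 0 < δ ∧ δ ≤ 1 ∧ ∀ z, δ ≤ (P ^ T) z s := by
    obtain ⟨z₁, -, hz₁⟩ := Finset.exists_min_image Finset.univ (fun z => (P ^ T) z s)
      ⟨s, Finset.mem_univ s⟩
    refine ⟨_, hT z₁, ?_, fun z => hz₁ z (Finset.mem_univ z)⟩
    rw [← hsum T z₁]
    exact Finset.single_le_sum (fun w _ => hnn T z₁ w) (Finset.mem_univ s)
  have upper : ∀ (k : ℕ) (c M : ℝ) (u : Z → ℝ), (∀ z, c ≤ (P ^ k) z s) → (∀ z, u z ≤ M) →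
      ∀ z, ∑ v, (P ^ k) z v * u v ≤ M - c * (M - u s) := by
    intro k c M u hc hu z
    have h1 : (P ^ k) z s * (M - u s) ≤ ∑ v, (P ^ k) z v * (M - u v) :=
      Finset.single_le_sum (f := fun v => (P ^ k) z v * (M - u v))
        (fun v _ => mul_nonneg (hnn _ _ _) (sub_nonneg.2 (hu v))) (Finset.mem_univ s)
    have h2 : ∑ v, (P ^ k) z v * (M - u v) = M - ∑ v, (P ^ k) z v * u v := by
      simp only [mul_sub, Finset.sum_sub_distrib, ← Finset.sum_mul, hsum, one_mul]
    have h3 := mul_le_mul_of_nonneg_right (hc z) (sub_nonneg.2 (hu s))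
    linarith
  have lower : ∀ (k : ℕ) (c M : ℝ) (u : Z → ℝ), (∀ z, c ≤ (P ^ k) z s) → (∀ z, M ≤ u z) →
      ∀ z, M + c * (u s - M) ≤ ∑ v, (P ^ k) z v * u v := by
    intro k c M u hc hu z
    have := upper k c (-M) (fun v => - u v) hc (fun z => neg_le_neg (hu z)) z
    simp only [mul_neg, Finset.sum_neg_distrib] at this
    linarith
  have hosc : ∀ (w : Z) (j : ℕ), ∃ m M : ℝ, M - m ≤ (1 - δ) ^ j ∧
      ∀ z, m ≤ (P ^ (T * j)) z w ∧ (P ^ (T * j)) z w ≤ M := by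
    intro w j
    induction j with
    | zero =>
      refine ⟨0, 1, by simp, fun z => ⟨hnn _ _ _, ?_⟩⟩
      rw [← hsum (T * 0) z]
      exact Finset.single_le_sum (fun v _ => hnn _ z v) (Finset.mem_univ w)
    | succ j ih =>
      obtain ⟨m, M, hmM, hb⟩ := ih
      refine ⟨m + δ * ((P ^ (T * j)) s w - m), M - δ * (M - (P ^ (T * j)) s w), ?_, fun z => ?_⟩
      · rw [pow_succ]
        nlinarith
      · rw [mul_add, mul_one, add_comm (T * j), pow_add, Matrix.mul_apply]
        exact ⟨lower T δ m _ hδ (fun z => (hb z).1) z, upper T δ M _ hδ (fun z => (hb z).2) z⟩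
  have hclose : ∀ w, ∀ η > 0, ∃ K, ∀ k ≥ K, ∀ l ≥ K, ∀ z z',
      |(P ^ k) z w - (P ^ l) z' w| ≤ η := by
    intro w η hη
    obtain ⟨j, hj⟩ := exists_pow_lt_of_lt_one hη (show 1 - δ < 1 by linarith)
    obtain ⟨m, M, hmM, hb⟩ := hosc w j
    have hb' : ∀ k ≥ T * j, ∀ z, m ≤ (P ^ k) z w ∧ (P ^ k) z w ≤ M := by
      intro k hk z
      obtain ⟨l, rfl⟩ := Nat.exists_eq_add_of_le hk
      rw [add_comm, pow_add, Matrix.mul_apply]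
      have h1 := lower l 0 m _ (fun z => hnn _ _ _) (fun z => (hb z).1) z
      have h2 := upper l 0 M _ (fun z => hnn _ _ _) (fun z => (hb z).2) z
      constructor <;> linarith
    refine ⟨T * j, fun k hk l hl z z' => ?_⟩
    have h1 := hb' k hk z
    have h2 := hb' l hl z'
    rw [abs_le]
    constructor <;> linarith
  have hlim : ∀ w, ∃ x, Tendsto (fun k => (P ^ k) s w) atTop (𝓝 x) := by
    intro w
    apply cauchySeq_tendsto_of_complete
    rw [Metric.cauchySeq_iff]
    intro η hη
    obtain ⟨K, hK⟩ := hclose w (η / 2) (half_pos hη)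
    exact ⟨K, fun k hk l hl => lt_of_le_of_lt (hK k hk l hl s s) (half_lt_self hη)⟩
  choose π hπ using hlim
  have hπ' : ∀ z w, Tendsto (fun k => (P ^ k) z w) atTop (𝓝 (π w)) := by
    intro z w
    rw [Metric.tendsto_atTop]
    intro η hη
    obtain ⟨K, hK⟩ := hclose w (η / 2) (half_pos hη)
    refine ⟨K, fun k hk => lt_of_le_of_lt ?_ (half_lt_self hη)⟩
    rw [Real.dist_eq]
    refine le_of_tendsto ((tendsto_const_nhds.sub (hπ w)).abs) ?_
    filter_upwards [eventually_ge_atTop K] with l hl using hK k hk l hl z s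
  refine ⟨π, fun z => ge_of_tendsto' (hπ z) (fun k => hnn k s z), ?_, fun w => ?_, hπ'⟩
  · have h := tendsto_finsetSum Finset.univ (fun z _ => hπ z)
    simp only [hsum] at h
    exact tendsto_nhds_unique h tendsto_const_nhds
  · have h := tendsto_finsetSum Finset.univ (fun z _ => (hπ z).mul_const (P z w))
    simp only [← Matrix.mul_apply, ← pow_succ] at h
    exact tendsto_nhds_unique h ((hπ w).comp (tendsto_add_atTop_nat 1))

/-- Probability of entering `H` through `S`, as a solution of the Dirichlet problem: it lies below
every supersolution. -/
theorem exists_harmonic {Z : Type*} [Fintype Z] (P : Z → Z → ℝ) (h0 : ∀ z w, 0 ≤ P z w)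
    (h1 : ∀ z, ∑ w, P z w = 1) (H S : Set Z) (hSH : S ⊆ H) :
    ∃ f : Z → ℝ, (∀ z, 0 ≤ f z) ∧ (∀ z, f z ≤ 1) ∧ (∀ z ∈ S, f z = 1) ∧
      (∀ z ∈ H, z ∉ S → f z = 0) ∧ (∀ z ∉ H, f z = ∑ w, P z w * f w) ∧
      ∀ g : Z → ℝ, (∀ z, 0 ≤ g z) → (∀ z ∈ S, 1 ≤ g z) →
        (∀ z ∉ H, ∑ w, P z w * g w ≤ g z) → ∀ z, f z ≤ g z := by
  let step : (Z → ℝ) → Z → ℝ := fun f z =>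
    if z ∈ S then 1 else if z ∈ H then 0 else ∑ w, P z w * f w
  let F : ℕ → Z → ℝ := fun t => step^[t] 0
  have F0 : F 0 = 0 := rfl
  have Fs : ∀ t, F (t + 1) = step (F t) := fun t => Function.iterate_succ_apply' step t 0
  have bound : ∀ g : Z → ℝ, (∀ z, 0 ≤ g z) → (∀ z ∈ S, 1 ≤ g z) →
      (∀ z ∉ H, ∑ w, P z w * g w ≤ g z) → ∀ t z, F t z ≤ g z := by
    intro g hg hgS hgH t
    induction t with
    | zero => intro z; exact hg z
    | succ t ih =>
      intro z
      rw [Fs]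
      by_cases hz : z ∈ S
      · simp only [step, if_pos hz]; exact hgS z hz
      by_cases hz' : z ∈ H
      · simp only [step, if_neg hz, if_pos hz']; exact hg z
      simp only [step, if_neg hz, if_neg hz']
      exact (Finset.sum_le_sum fun w _ => mul_le_mul_of_nonneg_left (ih w) (h0 z w)).trans
        (hgH z hz')
  have stepmono : Monotone step := by
    intro f g hfg z
    simp only [step]
    split_ifs
    · exact le_rfl
    · exact le_rfl
    · exact Finset.sum_le_sum fun w _ => mul_le_mul_of_nonneg_left (hfg w) (h0 z w)
  have Fmono : Monotone F := by
    apply monotone_nat_of_le_succ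
    intro t
    induction t with
    | zero =>
      intro z
      rw [Fs, F0]
      simp only [step]
      split_ifs <;> simp
    | succ t ih =>
      rw [Fs (t + 1), Fs t]
      exact stepmono (by rw [← Fs]; exact ih)
  have F1 : ∀ t z, F t z ≤ 1 := bound 1 (fun _ => zero_le_one) (fun _ _ => le_rfl)
    (fun z _ => by simp [h1])
  have hconv : ∀ z, ∃ x, Tendsto (fun t => F t z) atTop (𝓝 x) := fun z =>
    ⟨_, tendsto_atTop_ciSup (fun s t hst => Fmono hst z) ⟨1, by rintro _ ⟨t, rfl⟩; exact F1 t z⟩⟩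
  choose f hf using hconv
  have hf' : ∀ z, Tendsto (fun t => step (F t) z) atTop (𝓝 (f z)) := fun z => by
    simpa only [Fs, Function.comp_def] using (hf z).comp (tendsto_add_atTop_nat 1)
  refine ⟨f, fun z => ge_of_tendsto' (hf z) fun t => Fmono (Nat.zero_le t) z,
    fun z => le_of_tendsto' (hf z) fun t => F1 t z, fun z hz => ?_, fun z hz hz' => ?_,
    fun z hz => ?_, fun g hg hgS hgH z => le_of_tendsto' (hf z) fun t => bound g hg hgS hgH t z⟩
  · have := hf' z
    simp only [step, if_pos hz] at this
    exact tendsto_nhds_unique this tendsto_const_nhds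
  · have := hf' z
    simp only [step, if_neg hz', if_pos hz] at this
    exact tendsto_nhds_unique this tendsto_const_nhds
  · have := hf' z
    simp only [step, if_neg (fun h => hz (hSH h)), if_neg hz] at this
    exact tendsto_nhds_unique this (tendsto_finsetSum _ fun w _ => (hf w).const_mul _)

theorem le_pow_card_mul_of_cuts {V : Type*} [Fintype V] (ρ : V → ℝ) (R : ℝ) (hR : 1 ≤ R)
    (hρ : ∀ v, 0 ≤ ρ v)
    (hcut : ∀ S : Finset V, S.Nonempty → S ≠ Finset.univ → ∃ a ∉ S, ∃ b ∈ S, ρ a ≤ R * ρ b)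
    (x y : V) : ρ x ≤ R ^ Fintype.card V * ρ y := by
  have grow : ∀ k, k < Fintype.card V → ∃ S : Finset V, y ∈ S ∧ S.card = k + 1 ∧
      ∀ b ∈ S, ρ b ≤ R ^ k * ρ y := by
    intro k
    induction k with
    | zero => intro _; exact ⟨{y}, by simp, by simp, by simp⟩
    | succ k ih =>
      intro hk
      obtain ⟨S, hy, hS, hb⟩ := ih (by omega)
      obtain ⟨a, ha, b, hbS, hab⟩ := hcut S ⟨y, hy⟩ (by
        rintro rfl
        rw [Finset.card_univ] at hS
        omega)
      refine ⟨insert a S, by simp [hy], by simp [ha, hS], fun c hc => ?_⟩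
      have hk' : R ^ k * ρ y ≤ R ^ (k + 1) * ρ y :=
        mul_le_mul_of_nonneg_right (pow_le_pow_right₀ hR (Nat.le_succ k)) (hρ y)
      rcases Finset.mem_insert.1 hc with rfl | hc
      · calc ρ c ≤ R * ρ b := hab
          _ ≤ R * (R ^ k * ρ y) := mul_le_mul_of_nonneg_left (hb b hbS) (by linarith)
          _ = R ^ (k + 1) * ρ y := by ring
      · exact (hb c hc).trans hk'
  have hpos : 0 < Fintype.card V := Fintype.card_pos_iff.2 ⟨x⟩
  obtain ⟨S, -, hS, hb⟩ := grow (Fintype.card V - 1) (by omega)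
  have hx : x ∈ S := by
    rw [Finset.card_eq_iff_eq_univ S |>.1 (by omega)]
    exact Finset.mem_univ x
  exact (hb x hx).trans (mul_le_mul_of_nonneg_right
    (pow_le_pow_right₀ hR (Nat.sub_le _ _)) (hρ y))

set_option linter.unusedSectionVars false

section Game

variable {ι : Type*} [Fintype ι] [DecidableEq ι] {A : ι → Type*} [∀ i, Fintype (A i)]
  {U : ι → (∀ i, A i) → ℝ} {C : ∀ i, A i → Finset (A i)} {φ : (∀ i, A i) → ℝ} {κ ε : ℝ}
  {x y a b c s : ∀ i, A i} {i : ι}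

/-- The standing assumptions on the parameters of PHPIP. -/
structure Admissible (C : ∀ i, A i → Finset (A i)) (κ ε : ℝ) : Prop where
  ε_pos : 0 < ε
  ε_le : ε ≤ 1 / 2
  κ_pos : 0 < κ
  κ_le : κ ≤ 1 / 2
  constraints : Assumption1 C

/-- In state `(x, y)`, choosing `u` is a genuine exploration of player `i`, as opposed to keeping
the current action or returning to the previous one after a loss. -/
def Explores (U : ι → (∀ i, A i) → ℝ) (x y : ∀ i, A i) (i : ι) (u : A i) : Prop :=
  u ≠ y i ∧ ¬(U i y < U i x ∧ u = x i)

/-- Number of players exploring in the transition from `(x, y)` to `(y, c)`. -/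
noncomputable def numExplorers (U : ι → (∀ i, A i) → ℝ) (x y c : ∀ i, A i) : ℕ :=
  (Finset.univ.filter fun i => Explores U x y i (c i)).card

/-- Probability of the transition from `(x, y)` to `(y, c)`. -/
noncomputable def jointProb (κ : ℝ) (U : ι → (∀ i, A i) → ℝ) (C : ∀ i, A i → Finset (A i))
    (ε : ℝ) (x y c : ∀ i, A i) : ℝ :=
  ∏ i, selProb κ U C ε x y i (c i)

theorem sum_phTrans_mul (f : (∀ i, A i) × (∀ i, A i) → ℝ) (z : (∀ i, A i) × (∀ i, A i)) :
    ∑ w, phTrans κ U C ε z w * f w = ∑ c, jointProb κ U C ε z.1 z.2 c * f (z.2, c) := by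
  rw [Fintype.sum_prod_type, Finset.sum_eq_single z.2]
  · simp [phTrans, jointProb]
  · intro b _ hb
    simp [phTrans, hb]
  · simp

theorem Admissible.rpow_le_one (h : Admissible C κ ε) {r : ℝ} (hr : 0 ≤ r) : ε ^ r ≤ 1 :=
  Real.rpow_le_one h.ε_pos.le (by linarith [h.ε_le]) hr

theorem Admissible.retain_mem_Icc (h : Admissible C κ ε) {r : ℝ} (hr : 0 ≤ r) :
    0 ≤ κ * ε ^ r ∧ κ * ε ^ r ≤ 1 / 2 := by
  have h1 := h.rpow_le_one hr
  have h2 := Real.rpow_nonneg h.ε_pos.le r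
  have h3 := h.κ_pos
  have h4 := h.κ_le
  constructor
  · positivity
  · nlinarith

theorem selProb_nonneg (h : Admissible C κ ε) (x y : ∀ i, A i) (i : ι) (u : A i) :
    0 ≤ selProb κ U C ε x y i u := by
  have he := h.ε_pos
  have he' := h.ε_le
  unfold selProb
  split_ifs with h1 <;> try positivity
  all_goals
    try have hd := h.retain_mem_Icc (r := U i x - U i y) (by linarith [not_le.1 h1])
  all_goals
    first
    | (have : 0 ≤ 1 - ε := by linarith
       positivity)
    | (have h2 : 0 ≤ (1 - ε) * (κ * ε ^ (U i x - U i y)) :=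
         mul_nonneg (by linarith) hd.1
       have h3 : 0 ≤ (1 - ε) * (1 - κ * ε ^ (U i x - U i y)) :=
         mul_nonneg (by linarith) (by linarith [hd.2])
       positivity)

theorem card_erase_pos (h : Admissible C κ ε) (i : ι) (u v : A i) :
    0 < (((C i u).erase v).card : ℝ) ∧ 0 < ((((C i u).erase v).erase (x i)).card : ℝ) := by
  have h1 := h.constraints.2.2 i u
  have h2 := Finset.pred_card_le_card_erase (s := C i u) (a := v)
  have h3 := Finset.pred_card_le_card_erase (s := (C i u).erase v) (a := x i)
  constructor <;> norm_cast <;> omega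

theorem sum_selProb (h : Admissible C κ ε) (x y : ∀ i, A i) (i : ι) :
    ∑ u, selProb κ U C ε x y i u = 1 := by
  have hc := card_erase_pos (x := x) h i (y i) (y i)
  unfold selProb
  split_ifs
  · rw [Finset.sum_add_distrib, Finset.sum_ite_eq', if_pos (Finset.mem_univ _), Finset.sum_ite_mem,
      Finset.univ_inter, Finset.sum_const, nsmul_eq_mul, mul_div_cancel₀ _ hc.1.ne']
    ring
  · rw [Finset.sum_add_distrib, Finset.sum_add_distrib, Finset.sum_ite_eq',
      if_pos (Finset.mem_univ _), Finset.sum_ite_eq', if_pos (Finset.mem_univ _),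
      Finset.sum_ite_mem, Finset.univ_inter, Finset.sum_const, nsmul_eq_mul,
      mul_div_cancel₀ _ hc.2.ne']
    ring

theorem selProb_le_one (h : Admissible C κ ε) (x y : ∀ i, A i) (i : ι) (u : A i) :
    selProb κ U C ε x y i u ≤ 1 := by
  rw [← sum_selProb (U := U) h x y i]
  exact Finset.single_le_sum (fun v _ => selProb_nonneg h x y i v) (Finset.mem_univ u)

theorem jointProb_nonneg (h : Admissible C κ ε) (x y c : ∀ i, A i) :
    0 ≤ jointProb κ U C ε x y c :=
  Finset.prod_nonneg fun i _ => selProb_nonneg h x y i _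

theorem jointProb_le_one (h : Admissible C κ ε) (x y c : ∀ i, A i) :
    jointProb κ U C ε x y c ≤ 1 :=
  Finset.prod_le_one (fun i _ => selProb_nonneg h x y i _) fun i _ => selProb_le_one h x y i _

theorem sum_jointProb (h : Admissible C κ ε) (x y : ∀ i, A i) :
    ∑ c, jointProb κ U C ε x y c = 1 := by
  unfold jointProb
  rw [← Fintype.prod_sum fun i u => selProb κ U C ε x y i u]
  simp [sum_selProb h]

theorem selProb_le_of_explores (h : Admissible C κ ε) {u : A i} (hu : Explores U x y i u) :
    selProb κ U C ε x y i u ≤ ε := by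
  have hc := card_erase_pos (x := x) h i (y i) (y i)
  have hc1 : (1 : ℝ) ≤ ((C i (y i)).erase (y i)).card := by
    exact_mod_cast hc.1
  have hc2 : (1 : ℝ) ≤ (((C i (y i)).erase (y i)).erase (x i)).card := by
    exact_mod_cast hc.2
  obtain ⟨h1, h2⟩ := hu
  have he := h.ε_pos
  unfold selProb
  by_cases hd : U i x ≤ U i y
  · rw [if_pos hd, if_neg h1, zero_add]
    split_ifs
    · exact div_le_self he.le hc1
    · exact he.le
  · rw [if_neg hd, if_neg h1, if_neg fun h3 => h2 ⟨not_le.1 hd, h3⟩, zero_add, zero_add]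
    split_ifs
    · exact div_le_self he.le hc2
    · exact he.le

theorem mem_of_explores {u : A i} (hu : Explores U x y i u)
    (h0 : selProb κ U C ε x y i u ≠ 0) : u ∈ C i (y i) := by
  obtain ⟨h1, h2⟩ := hu
  by_contra hC
  apply h0
  unfold selProb
  by_cases hd : U i x ≤ U i y
  · simp [hd, h1, hC]
  · have h3 : u ≠ x i := fun h3 => h2 ⟨not_le.1 hd, h3⟩
    simp [hd, h1, hC, h3]

theorem selProb_stay_of_le (h : U i x ≤ U i y) :
    selProb κ U C ε x y i (y i) = 1 - ε := by
  simp [selProb, h]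

theorem selProb_stay_of_eq (h : x i = y i) : selProb κ U C ε x y i (y i) = 1 - ε := by
  by_cases hd : U i x ≤ U i y
  · exact selProb_stay_of_le hd
  · simp [selProb, hd, h]
    ring

theorem selProb_stay_of_lt (h : U i y < U i x) (hxy : x i ≠ y i) :
    selProb κ U C ε x y i (y i) = (1 - ε) * (κ * ε ^ (U i x - U i y)) := by
  simp [selProb, not_le.2 h, hxy.symm]

theorem jointProb_le_pow (h : Admissible C κ ε) (x y c : ∀ i, A i) :
    jointProb κ U C ε x y c ≤ ε ^ numExplorers U x y c := by
  calc jointProb κ U C ε x y c ≤ ∏ i, if Explores U x y i (c i) then ε else 1 := by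
        refine Finset.prod_le_prod (fun i _ => selProb_nonneg h x y i _) fun i _ => ?_
        split_ifs with hi
        · exact selProb_le_of_explores h hi
        · exact selProb_le_one h x y i _
    _ = _ := by simp [Finset.prod_ite, numExplorers]

theorem jointProb_le_of_explores (h : Admissible C κ ε) (hi : Explores U x y i (c i)) :
    jointProb κ U C ε x y c ≤ ε := by
  refine (jointProb_le_pow h x y c).trans (pow_le_of_le_one h.ε_pos.le (by linarith [h.ε_le]) ?_)
  exact (Finset.card_pos.2 ⟨i, by simpa using hi⟩).ne'

theorem mem_of_jointProb_ne_zero (h0 : jointProb κ U C ε x y c ≠ 0)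
    (hi : Explores U x y i (c i)) : c i ∈ C i (y i) :=
  mem_of_explores hi (Finset.prod_ne_zero_iff.1 h0 i (Finset.mem_univ i))

/-- Distance between actions of player `i` in the graph of feasible moves. -/
noncomputable def actionDist (C : ∀ i, A i → Finset (A i)) (i : ι) (u v : A i) : ℕ :=
  (SimpleGraph.fromRel fun p q : A i => q ∈ C i p).dist u v

theorem connected_actions (h : Assumption1 C) (i : ι) (u : A i) :
    (SimpleGraph.fromRel fun p q : A i => q ∈ C i p).Connected := by
  have : Nonempty (A i) := ⟨u⟩
  refine ⟨fun p q => ?_⟩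
  obtain ⟨m, f, rfl, rfl, hf⟩ := h.2.1 i p q
  induction m with
  | zero => exact SimpleGraph.Reachable.refl _
  | succ m ih =>
    refine (ih fun k hk => hf k (by omega)).trans ?_
    by_cases he : f m = f (m + 1)
    · rw [he]
    · exact SimpleGraph.Adj.reachable
        ((SimpleGraph.fromRel_adj _ _ _).2 ⟨he, Or.inl (hf m (by omega))⟩)

theorem actionDist_le_succ (h : Assumption1 C) {i : ι} {u v : A i} (huv : v ∈ C i u) (w : A i) :
    actionDist C i u w ≤ actionDist C i v w + 1 := by
  unfold actionDist
  by_cases he : u = v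
  · rw [he]; omega
  have hadj : (SimpleGraph.fromRel fun p q : A i => q ∈ C i p).Adj u v :=
    (SimpleGraph.fromRel_adj _ _ _).2 ⟨he, Or.inl huv⟩
  have := (connected_actions h i u).dist_triangle (u := u) (v := v) (w := w)
  rw [SimpleGraph.dist_eq_one_iff_adj.2 hadj] at this
  omega

theorem exists_actionDist_succ (h : Assumption1 C) {i : ι} {u w : A i} (huw : u ≠ w) :
    ∃ v ∈ C i u, v ≠ u ∧ actionDist C i u w = actionDist C i v w + 1 := by
  obtain ⟨p, hp⟩ := ((connected_actions h i u).preconnected u w).exists_walk_length_eq_dist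
  cases p with
  | nil => exact absurd rfl huw
  | cons hadj q =>
    rename_i v
    have hadj' := (SimpleGraph.fromRel_adj _ _ _).1 hadj
    have hv : v ∈ C i u := hadj'.2.elim id fun h' => (h.1 i u v).2 h'
    refine ⟨v, hv, hadj'.1.symm, le_antisymm (actionDist_le_succ h hv w) ?_⟩
    have := SimpleGraph.dist_le q
    rw [SimpleGraph.Walk.length_cons] at hp
    unfold actionDist
    omega

/-- Number of explorations needed to lead state `(x, y)` to the joint action `s`. -/
noncomputable def stateDist (C : ∀ i, A i → Finset (A i)) (s x y : ∀ i, A i) : ℕ :=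
  ∑ i, min (actionDist C i (x i) (s i)) (actionDist C i (y i) (s i))

theorem stateDist_self (C : ∀ i, A i → Finset (A i)) (s : ∀ i, A i) : stateDist C s s s = 0 := by
  simp [stateDist, actionDist]

theorem stateDist_le_add_numExplorers (h : Assumption1 C)
    (h0 : jointProb κ U C ε x y c ≠ 0) (s : ∀ i, A i) :
    stateDist C s x y ≤ stateDist C s y c + numExplorers U x y c := by
  unfold stateDist numExplorers
  rw [Finset.card_filter, ← Finset.sum_add_distrib]
  refine Finset.sum_le_sum fun i _ => ?_
  by_cases hi : Explores U x y i (c i)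
  · have := actionDist_le_succ h (mem_of_jointProb_ne_zero h0 hi) (s i)
    rw [if_pos hi]
    omega
  · rw [if_neg hi]
    have : c i = y i ∨ c i = x i := by
      unfold Explores at hi
      tauto
    rcases this with h' | h' <;> rw [h'] <;> omega

/-- A bound for the number of rounds until `(x, y)` becomes diagonal if nobody explores. -/
noncomputable def settleLevel (U : ι → (∀ i, A i) → ℝ) (x y : ∀ i, A i) : ℕ :=
  if x = y then 0 else 2 * (Finset.univ.filter fun i => x i ≠ y i).card +
    if ∀ i, x i ≠ y i → U i y < U i x then 1 else 0

theorem settleLevel_le (U : ι → (∀ i, A i) → ℝ) (x y : ∀ i, A i) :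
    settleLevel U x y ≤ 2 * Fintype.card ι + 1 := by
  have := Finset.card_filter_le Finset.univ (fun i => x i ≠ y i)
  rw [Finset.card_univ] at this
  unfold settleLevel
  split_ifs <;> omega

theorem settleLevel_lt (hxy : x ≠ y) (hc : ∀ i, ¬Explores U x y i (c i)) :
    settleLevel U y c < settleLevel U x y := by
  have hc' : ∀ i, y i ≠ c i → U i y < U i x ∧ c i = x i := fun i hi => by
    have := hc i
    unfold Explores at this
    by_contra h
    exact this ⟨hi.symm, h⟩
  obtain ⟨j, hj⟩ := Function.ne_iff.1 hxy
  have hpos : 0 < (Finset.univ.filter fun i => x i ≠ y i).card :=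
    Finset.card_pos.2 ⟨j, by simpa using hj⟩
  by_cases hyc : y = c
  · rw [settleLevel, if_pos hyc, settleLevel, if_neg hxy]
    omega
  rw [settleLevel, if_neg hyc, settleLevel, if_neg hxy]
  have hsub : (Finset.univ.filter fun i => y i ≠ c i) ⊆ Finset.univ.filter fun i => x i ≠ y i := by
    intro i hi
    simp only [Finset.mem_filter, Finset.mem_univ, true_and] at hi ⊢
    rw [← (hc' i hi).2]
    exact hi.symm
  by_cases heq : (Finset.univ.filter fun i => y i ≠ c i) = Finset.univ.filter fun i => x i ≠ y i
  · have hmoved : ∀ i, x i ≠ y i → U i y < U i x ∧ c i = x i := fun i hi => by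
      have : i ∈ Finset.univ.filter fun i => y i ≠ c i := by rw [heq]; simpa using hi
      exact hc' i (by simpa using this)
    have hcx : c = x := by
      funext i
      by_cases hi : x i = y i
      · by_contra hne
        exact hne (hc' i fun h => hne (by rw [← h, hi])).2
      · exact (hmoved i hi).2
    rw [heq, if_pos fun i hi => (hmoved i hi).1, if_neg]
    · omega
    · intro hall
      have h1 := hall j (by rw [hcx]; exact hj.symm)
      rw [hcx] at h1
      exact lt_asymm h1 (hmoved j hj).1
  · have := Finset.card_lt_card (hsub.ssubset_of_ne heq)
    split_ifs <;> omega

theorem pow_mul_jointProb_mul_le (h : Admissible C κ ε) {K : ℝ} (hK : 0 < K) (hKε : K * ε ≤ 1)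
    (s x y c : ∀ i, A i) :
    K ^ numExplorers U x y c * (jointProb κ U C ε x y c * (K * ε) ^ stateDist C s y c) ≤
      (K * ε) ^ stateDist C s x y := by
  have hpos : 0 < K * ε := mul_pos hK h.ε_pos
  by_cases h0 : jointProb κ U C ε x y c = 0
  · rw [h0, zero_mul, mul_zero]
    positivity
  calc K ^ numExplorers U x y c * (jointProb κ U C ε x y c * (K * ε) ^ stateDist C s y c)
      ≤ K ^ numExplorers U x y c * (ε ^ numExplorers U x y c * (K * ε) ^ stateDist C s y c) := by
        have := jointProb_le_pow (U := U) h x y c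
        gcongr
    _ = (K * ε) ^ (stateDist C s y c + numExplorers U x y c) := by
        rw [pow_add, mul_pow K ε (numExplorers U x y c)]
        ring
    _ ≤ _ := pow_le_pow_of_le_one hpos.le hKε
        (stateDist_le_add_numExplorers h.constraints h0 s)

theorem jointProb_mul_pow_stateDist_le (h : Admissible C κ ε) {K : ℝ} (hK : 1 ≤ K)
    (hKε : K * ε ≤ 1) (s x y c : ∀ i, A i) :
    jointProb κ U C ε x y c * (K * ε) ^ stateDist C s y c ≤ (K * ε) ^ stateDist C s x y := by
  have hK0 : 0 < K := by linarith
  refine le_trans ?_ (pow_mul_jointProb_mul_le (U := U) h hK0 hKε s x y c)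
  have := mul_nonneg (jointProb_nonneg (U := U) h x y c)
    (pow_nonneg (mul_nonneg hK0.le h.ε_pos.le) (stateDist C s y c))
  exact le_mul_of_one_le_left this (one_le_pow₀ hK)

/-- A supersolution controlling the probability of reaching `(s, s)` from `(x, y)` before any
other diagonal state. -/
noncomputable def barrier (U : ι → (∀ i, A i) → ℝ) (C : ∀ i, A i → Finset (A i)) (K ε : ℝ)
    (s x y : ∀ i, A i) : ℝ :=
  (K * ε) ^ stateDist C s x y * (1 + settleLevel U x y / (2 * Fintype.card ι + 1))

theorem barrier_factor_mem_Icc (U : ι → (∀ i, A i) → ℝ) (x y : ∀ i, A i) :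
    (1 + settleLevel U x y / (2 * Fintype.card ι + 1) : ℝ) ∈ Icc (1 : ℝ) 2 := by
  have h1 : (settleLevel U x y : ℝ) ≤ 2 * Fintype.card ι + 1 := by
    exact_mod_cast settleLevel_le U x y
  have h2 : (settleLevel U x y : ℝ) / (2 * Fintype.card ι + 1) ≤ 1 :=
    div_le_one_of_le₀ h1 (by positivity)
  have h3 : 0 ≤ (settleLevel U x y : ℝ) / (2 * Fintype.card ι + 1) := by positivity
  exact ⟨by linarith, by linarith⟩

theorem barrier_nonneg (h : Admissible C κ ε) {K : ℝ} (hK : 1 ≤ K) (s x y : ∀ i, A i) :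
    0 ≤ barrier U C K ε s x y :=
  mul_nonneg (pow_nonneg (mul_nonneg (by linarith) h.ε_pos.le) _)
    (by linarith [(barrier_factor_mem_Icc U x y).1])

theorem jointProb_mul_barrier_le (h : Admissible C κ ε) {K : ℝ} (hK : 1 ≤ K)
    (hKε : K * ε ≤ 1) (s x y c : ∀ i, A i) :
    jointProb κ U C ε x y c * barrier U C K ε s y c ≤ 2 * (K * ε) ^ stateDist C s x y := by
  have h1 := jointProb_mul_pow_stateDist_le (U := U) h hK hKε s x y c
  have h2 := (barrier_factor_mem_Icc U y c).2
  have h3 := (barrier_factor_mem_Icc U y c).1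
  have h4 : 0 ≤ (K * ε) ^ stateDist C s x y := pow_nonneg (mul_nonneg (by linarith) h.ε_pos.le) _
  rw [barrier, ← mul_assoc, mul_comm 2 (_ ^ _)]
  exact mul_le_mul h1 h2 (by linarith) h4

theorem sum_jointProb_mul_barrier_le (h : Admissible C κ ε) {K : ℝ} (hK : 1 ≤ K)
    (hKK : 2 * Fintype.card (∀ i, A i) * (2 * Fintype.card ι + 1) ≤ K)
    (hKε : K * ε ≤ 1) (s : ∀ i, A i) (hxy : x ≠ y) :
    ∑ c, jointProb κ U C ε x y c * barrier U C K ε s y c ≤ barrier U C K ε s x y := by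
  set L : ℝ := 2 * Fintype.card ι + 1 with hL
  have hL0 : 0 < L := by positivity
  have hK0 : 0 < K := by linarith
  set G := (K * ε) ^ stateDist C s x y with hG
  have hG0 : 0 ≤ G := pow_nonneg (mul_nonneg hK0.le h.ε_pos.le) _
  have hl1 : (1 : ℝ) ≤ settleLevel U x y := by
    have : 1 ≤ settleLevel U x y := by
      obtain ⟨j, hj⟩ := Function.ne_iff.1 hxy
      have : 0 < (Finset.univ.filter fun i => x i ≠ y i).card :=
        Finset.card_pos.2 ⟨j, by simpa using hj⟩
      rw [settleLevel, if_neg hxy]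
      omega
    exact_mod_cast this
  have hterm : ∀ c, jointProb κ U C ε x y c * barrier U C K ε s y c ≤
      G * (jointProb κ U C ε x y c * (1 + (settleLevel U x y - 1) / L) + 2 / K) := by
    intro c
    have hjp := jointProb_nonneg (U := U) h x y c
    have hfac : 0 ≤ 1 + (settleLevel U x y - 1) / L :=
      add_nonneg zero_le_one (div_nonneg (by linarith) hL0.le)
    by_cases hk : numExplorers U x y c = 0
    · have hne : ∀ i, ¬Explores U x y i (c i) := by
        intro i hi
        rw [numExplorers, Finset.card_eq_zero, Finset.filter_eq_empty_iff] at hk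
        exact hk (Finset.mem_univ i) hi
      have hlt : (settleLevel U y c : ℝ) ≤ settleLevel U x y - 1 := by
        have := settleLevel_lt hxy hne
        have : (settleLevel U y c : ℝ) + 1 ≤ settleLevel U x y := by exact_mod_cast this
        linarith
      by_cases h0 : jointProb κ U C ε x y c = 0
      · rw [h0]
        simp only [zero_mul, zero_add]
        positivity
      have hD : (K * ε) ^ stateDist C s y c ≤ G := by
        refine pow_le_pow_of_le_one (mul_nonneg hK0.le h.ε_pos.le) hKε ?_
        have := stateDist_le_add_numExplorers h.constraints h0 s
        omega
      have hfac' : 1 + (settleLevel U y c : ℝ) / L ≤ 1 + (settleLevel U x y - 1) / L := by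
        gcongr
      calc jointProb κ U C ε x y c * barrier U C K ε s y c
          ≤ jointProb κ U C ε x y c * (G * (1 + (settleLevel U x y - 1) / L)) := by
            unfold barrier
            have : 0 ≤ 1 + (settleLevel U y c : ℝ) / L := by positivity
            gcongr
        _ = G * (jointProb κ U C ε x y c * (1 + (settleLevel U x y - 1) / L)) := by ring
        _ ≤ _ := by
            have : 0 ≤ 2 / K := by positivity
            exact mul_le_mul_of_nonneg_left (by linarith) hG0
    · have h1 := pow_mul_jointProb_mul_le (U := U) h hK0 hKε s x y c
      set X := jointProb κ U C ε x y c * (K * ε) ^ stateDist C s y c with hX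
      have hX0 : 0 ≤ X := mul_nonneg hjp (pow_nonneg (mul_nonneg hK0.le h.ε_pos.le) _)
      have h2 : K * X ≤ G :=
        (mul_le_mul_of_nonneg_right (le_self_pow₀ hK hk) hX0).trans h1
      have h3 := (barrier_factor_mem_Icc U y c).2
      have h4 : X ≤ G / K := by rw [le_div_iff₀ hK0]; linarith
      calc jointProb κ U C ε x y c * barrier U C K ε s y c
          = X * (1 + settleLevel U y c / L) := by rw [barrier, ← mul_assoc]
        _ ≤ X * 2 := mul_le_mul_of_nonneg_left h3 hX0
        _ ≤ G / K * 2 := by gcongr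
        _ = G * (0 + 2 / K) := by ring
        _ ≤ _ := by gcongr; exact mul_nonneg hjp hfac
  refine (Finset.sum_le_sum fun c _ => hterm c).trans ?_
  rw [← Finset.mul_sum, Finset.sum_add_distrib, ← Finset.sum_mul, sum_jointProb h, one_mul,
    Finset.sum_const, Finset.card_univ, nsmul_eq_mul, barrier]
  refine mul_le_mul_of_nonneg_left ?_ hG0
  have : (Fintype.card (∀ i, A i) : ℝ) * (2 / K) ≤ 1 / L := by
    rw [mul_div_assoc', div_le_div_iff₀ hK0 hL0]
    linarith
  rw [sub_div]
  linarith

/-- `b` is obtained from `a` by a feasible deviation of one player. -/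
def SingleDev (C : ∀ i, A i → Finset (A i)) (a b : ∀ i, A i) : Prop :=
  ∃ i, ∃ u ∈ C i (a i), u ≠ a i ∧ b = Function.update a i u

theorem SingleDev.symm (h : Assumption1 C) (hab : SingleDev C a b) : SingleDev C b a := by
  obtain ⟨i, u, hu, hne, rfl⟩ := hab
  refine ⟨i, a i, ?_, ?_, ?_⟩
  · rw [Function.update_self]
    exact (h.1 i _ _).1 hu
  · rw [Function.update_self]
    exact hne.symm
  · simp

theorem SingleDev.abs_sub_le (h : Assumption1 C) (h3 : Assumption3 U C)
    (hpot : IsPotentialGame U C φ) (hab : SingleDev C a b) : |φ a - φ b| ≤ 1 / 2 := by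
  have key : ∀ {a b : ∀ i, A i}, SingleDev C a b → φ b - φ a ≤ 1 / 2 := by
    rintro a _ ⟨i, u, hu, -, rfl⟩
    rw [← hpot i a u hu]
    exact (h3 i a u hu).le
  have h1 := key hab
  have h2 := key (hab.symm h)
  rw [abs_le]
  constructor <;> linarith

theorem exists_singleDev_stateDist (h : Assumption1 C) (hbs : b ≠ s) :
    ∃ b', SingleDev C b b' ∧ stateDist C s b b = stateDist C s b' b' + 1 := by
  obtain ⟨i, hi⟩ := Function.ne_iff.1 hbs
  obtain ⟨w, hw, hwb, hdist⟩ := exists_actionDist_succ h hi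
  refine ⟨Function.update b i w, ⟨i, w, hw, hwb, rfl⟩, ?_⟩
  simp only [stateDist, min_self]
  rw [← Finset.add_sum_erase _ _ (Finset.mem_univ i), hdist, ← Finset.add_sum_erase _
    (fun j => actionDist C j (Function.update b i w j) (s j)) (Finset.mem_univ i)]
  have : ∑ j ∈ Finset.univ.erase i, actionDist C j (b j) (s j) =
      ∑ j ∈ Finset.univ.erase i, actionDist C j (Function.update b i w j) (s j) := by
    refine Finset.sum_congr rfl fun j hj => ?_
    rw [Function.update_of_ne (Finset.ne_of_mem_erase hj)]
  rw [this, Function.update_self]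
  ring

theorem exists_singleDev_crossing (h : Assumption1 C)
    (hφ : ∀ a b, SingleDev C a b → |φ a - φ b| ≤ 1 / 2) (S : Finset (∀ i, A i)) (hs : s ∈ S)
    (hb : b ∉ S) :
    ∃ u ∉ S, ∃ v ∈ S, SingleDev C u v ∧ φ b - min (φ u) (φ v) ≤ (stateDist C s b b : ℝ) / 2 ∧
      1 ≤ stateDist C s b b ∧ (2 ≤ stateDist C s b b ∨ u = b) := by
  induction hd : stateDist C s b b using Nat.strong_induction_on generalizing b with
  | _ d ih =>
  have hbs : b ≠ s := fun hbs => hb (hbs ▸ hs)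
  obtain ⟨b', hdev, hstep⟩ := exists_singleDev_stateDist h hbs
  rw [hd] at hstep
  have habs := abs_le.1 (hφ _ _ hdev)
  have hdR : (d : ℝ) = stateDist C s b' b' + 1 := by exact_mod_cast hstep
  by_cases hb'S : b' ∈ S
  · refine ⟨b, hb, b', hb'S, hdev, ?_, by omega, Or.inr rfl⟩
    have : (0 : ℝ) ≤ stateDist C s b' b' := Nat.cast_nonneg _
    rcases min_choice (φ b) (φ b') with hm | hm <;> rw [hm] <;> linarith
  · obtain ⟨u, hu, v, hv, huv, hle, h1, -⟩ := ih _ (by omega) hb'S rfl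
    exact ⟨u, hu, v, hv, huv, by linarith, by omega, Or.inl (by omega)⟩

theorem numExplorers_self (a c : ∀ i, A i) :
    numExplorers U a a c = (Finset.univ.filter fun i => c i ≠ a i).card := by
  simp [numExplorers, Explores]

theorem prod_ge_of_half_le {f : ι → ℝ} {t : ℝ} (i : ι) (ht : 0 ≤ t) (hi : t ≤ f i)
    (hf : ∀ j ≠ i, 1 / 2 ≤ f j) : t * (1 / 2) ^ Fintype.card ι ≤ ∏ j, f j := by
  rw [← Finset.mul_prod_erase _ _ (Finset.mem_univ i)]
  have h1 : (1 / 2 : ℝ) ^ (Finset.univ.erase i).card ≤ ∏ j ∈ Finset.univ.erase i, f j := by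
    rw [← Finset.prod_const]
    exact Finset.prod_le_prod (fun _ _ => by norm_num) fun j hj => hf j (Finset.ne_of_mem_erase hj)
  have h2 : (1 / 2 : ℝ) ^ Fintype.card ι ≤ (1 / 2 : ℝ) ^ (Finset.univ.erase i).card :=
    pow_le_pow_of_le_one (by norm_num) (by norm_num) (Finset.card_le_univ _)
  exact mul_le_mul hi (h2.trans h1) (by positivity) (ht.trans hi)

theorem SingleDev.le_jointProb_explore (h : Admissible C κ ε) (hab : SingleDev C a b) :
    ε / (∑ i, Fintype.card (A i) + 1) * (1 / 2) ^ Fintype.card ι ≤ jointProb κ U C ε a a b := by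
  obtain ⟨i, u, hu, hne, rfl⟩ := hab
  have he := h.ε_pos
  refine prod_ge_of_half_le i (by positivity) ?_ fun j hj => ?_
  · have hc : 0 < ((C i (a i)).erase (a i)).card := Finset.card_pos.2 ⟨u, by simp [hu, hne]⟩
    have hle : ((C i (a i)).erase (a i)).card ≤ ∑ i, Fintype.card (A i) + 1 := by
      have h1 := Finset.card_le_univ ((C i (a i)).erase (a i))
      have h2 : Fintype.card (A i) ≤ ∑ i, Fintype.card (A i) :=
        Finset.single_le_sum (f := fun i => Fintype.card (A i)) (fun _ _ => Nat.zero_le _)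
          (Finset.mem_univ i)
      omega
    have heq : selProb κ U C ε a a i (Function.update a i u i) =
        ε / ((C i (a i)).erase (a i)).card := by
      simp [selProb, hne, hu]
    rw [heq]
    have hc' : (0 : ℝ) < ((C i (a i)).erase (a i)).card := by exact_mod_cast hc
    have hle' : (((C i (a i)).erase (a i)).card : ℝ) ≤ (∑ i, Fintype.card (A i) : ℕ) + 1 := by
      exact_mod_cast hle
    exact div_le_div_of_nonneg_left he.le hc' hle'
  · rw [Function.update_of_ne hj, selProb_stay_of_le le_rfl]
    linarith [h.ε_le]

theorem SingleDev.le_jointProb_settle (h : Admissible C κ ε) (hpot : IsPotentialGame U C φ)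
    (hab : SingleDev C a b) :
    κ / 2 * ε ^ max (φ a - φ b) 0 * (1 / 2) ^ Fintype.card ι ≤ jointProb κ U C ε a b b := by
  obtain ⟨i, u, hu, hne, rfl⟩ := hab
  have he := h.ε_pos
  have he' := h.ε_le
  have hk := h.κ_pos
  have hk' := h.κ_le
  have hU := hpot i a u hu
  refine prod_ge_of_half_le i (by positivity) ?_ fun j hj => ?_
  · rcases le_or_gt (U i a) (U i (Function.update a i u)) with hle | hlt
    · rw [selProb_stay_of_le hle, max_eq_right (by linarith), Real.rpow_zero]
      linarith
    · rw [selProb_stay_of_lt hlt (by simpa using hne.symm), max_eq_left (by linarith),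
        show U i a - U i (Function.update a i u) = φ a - φ (Function.update a i u) by linarith]
      have : 0 ≤ κ * ε ^ (φ a - φ (Function.update a i u)) := by positivity
      nlinarith
  · rw [selProb_stay_of_eq (by rw [Function.update_of_ne hj])]
    linarith

theorem SingleDev.jointProb_settle_le (h : Admissible C κ ε) (hpot : IsPotentialGame U C φ)
    (hab : SingleDev C a b) : jointProb κ U C ε a b b ≤ ε ^ max (φ a - φ b) 0 := by
  obtain ⟨i, u, hu, hne, rfl⟩ := hab
  have hU := hpot i a u hu
  rcases le_or_gt (U i a) (U i (Function.update a i u)) with hle | hlt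
  · rw [max_eq_right (by linarith), Real.rpow_zero]
    exact jointProb_le_one h _ _ _
  · rw [max_eq_left (by linarith)]
    calc jointProb κ U C ε a (Function.update a i u) (Function.update a i u)
        ≤ selProb κ U C ε a (Function.update a i u) i (Function.update a i u i) := by
          rw [jointProb, ← Finset.mul_prod_erase _ _ (Finset.mem_univ i)]
          exact mul_le_of_le_one_right (selProb_nonneg h _ _ _ _) (Finset.prod_le_one
            (fun j _ => selProb_nonneg h _ _ j _) fun j _ => selProb_le_one h _ _ j _)
      _ = (1 - ε) * (κ * ε ^ (φ a - φ (Function.update a i u))) := by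
          rw [selProb_stay_of_lt hlt (by simpa using hne.symm),
            show U i a - U i (Function.update a i u) = φ a - φ (Function.update a i u) by linarith]
      _ ≤ _ := by
          have h1 := Real.rpow_nonneg h.ε_pos.le (φ a - φ (Function.update a i u))
          have h2 : (1 - ε) * κ ≤ 1 := by nlinarith [h.ε_pos, h.ε_le, h.κ_pos, h.κ_le]
          rw [← mul_assoc]
          exact mul_le_of_le_one_left h1 h2

theorem sum_jointProb_mul_le {M : ℝ} {f : (∀ i, A i) → ℝ}
    (hM : ∀ c, jointProb κ U C ε x y c * f c ≤ M) :
    ∑ c, jointProb κ U C ε x y c * f c ≤ Fintype.card (∀ i, A i) * M := by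
  rw [← nsmul_eq_mul, ← Finset.card_univ]
  exact Finset.sum_le_card_nsmul _ _ _ fun c _ => hM c

/-- `f` is the probability of hitting the diagonal within `S`. -/
structure IsHitting (κ : ℝ) (U : ι → (∀ i, A i) → ℝ) (C : ∀ i, A i → Finset (A i)) (ε : ℝ)
    (S : Finset (∀ i, A i)) (f : (∀ i, A i) × (∀ i, A i) → ℝ) : Prop where
  nonneg : ∀ z, 0 ≤ f z
  le_one : ∀ z, f z ≤ 1
  eq_one : ∀ a ∈ S, f (a, a) = 1
  eq_zero : ∀ a ∉ S, f (a, a) = 0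
  harmonic : ∀ x y, x ≠ y → f (x, y) = ∑ c, jointProb κ U C ε x y c * f (y, c)
  le_of_superharmonic : ∀ g : (∀ i, A i) × (∀ i, A i) → ℝ, (∀ z, 0 ≤ g z) →
    (∀ a ∈ S, 1 ≤ g (a, a)) →
    (∀ x y, x ≠ y → ∑ c, jointProb κ U C ε x y c * g (y, c) ≤ g (x, y)) → ∀ z, f z ≤ g z

theorem phTrans_nonneg (h : Admissible C κ ε) (z w : (∀ i, A i) × (∀ i, A i)) :
    0 ≤ phTrans κ U C ε z w := by
  unfold phTrans
  split_ifs
  · exact jointProb_nonneg h _ _ _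
  · exact le_rfl

theorem sum_phTrans (h : Admissible C κ ε) (z : (∀ i, A i) × (∀ i, A i)) :
    ∑ w, phTrans κ U C ε z w = 1 := by
  simpa [sum_jointProb h] using sum_phTrans_mul (κ := κ) (U := U) (C := C) (ε := ε) (fun _ => 1) z

theorem exists_isHitting (h : Admissible C κ ε) (S : Finset (∀ i, A i)) :
    ∃ f, IsHitting κ U C ε S f := by
  obtain ⟨f, h0, h1, hS, hH, hh, hg⟩ := exists_harmonic (phTrans κ U C ε) (phTrans_nonneg h)
    (sum_phTrans h) {z | z.1 = z.2} {z | z.1 = z.2 ∧ z.1 ∈ S} fun z hz => hz.1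
  simp only [sum_phTrans_mul] at hh hg
  refine ⟨f, h0, h1, fun a ha => hS _ ⟨rfl, ha⟩, fun a ha => hH _ rfl fun h => ha h.2,
    fun x y hxy => hh (x, y) hxy, fun g hg0 hgS hgh => hg g hg0 ?_ fun z hz => hgh z.1 z.2 hz⟩
  rintro ⟨a, _⟩ ⟨rfl : a = _, ha⟩
  exact hgS a ha

namespace IsHitting

variable {S : Finset (∀ i, A i)} {f : (∀ i, A i) × (∀ i, A i) → ℝ}

theorem jointProb_mul_le (hf : IsHitting κ U C ε S f) (h : Admissible C κ ε)
    (x y : ∀ i, A i) (z : (∀ i, A i) × (∀ i, A i)) :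
    jointProb κ U C ε x y c * f z ≤ jointProb κ U C ε x y c :=
  mul_le_of_le_one_right (jointProb_nonneg h x y c) (hf.le_one z)

/-- After a unilateral deviation from `b`, the chain settles in `S` without further exploration
only by keeping the deviation. -/
theorem le_of_singleDev (hf : IsHitting κ U C ε S f) (h : Admissible C κ ε)
    (hpot : IsPotentialGame U C φ) (hb : b ∉ S) (hbc : SingleDev C b c) :
    f (b, c) ≤ (if c ∈ S then ε ^ max (φ b - φ c) 0 else 0) +
      2 * Fintype.card (∀ i, A i) * ε := by
  have he := h.ε_pos
  set N : ℝ := ((Fintype.card (∀ i, A i) : ℕ) : ℝ) with hN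
  have hN0 : 0 ≤ N := Nat.cast_nonneg _
  set q : ℝ := if c ∈ S then ε ^ max (φ b - φ c) 0 else 0 with hq
  have hq0 : 0 ≤ q := by
    rw [hq]
    split_ifs
    · exact Real.rpow_nonneg he.le _
    · exact le_rfl
  have hself := hbc.jointProb_settle_le (U := U) h hpot
  obtain ⟨i, u, hu, hne, hc⟩ := hbc
  have hcj : ∀ j ≠ i, c j = b j := fun j hj => by rw [hc, Function.update_of_ne hj]
  have hci : c i ≠ b i := by rw [hc, Function.update_self]; exact hne
  have hcb : c ≠ b := fun h' => hci (by rw [h'])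
  have hback : U i c < U i b → f (c, b) ≤ N * ε := by
    intro hlt
    rw [hf.harmonic c b hcb]
    refine sum_jointProb_mul_le fun e => ?_
    by_cases heb : e = b
    · rw [heb, hf.eq_zero b hb, mul_zero]
      exact he.le
    obtain ⟨j, hj⟩ := Function.ne_iff.1 heb
    refine (hf.jointProb_mul_le h _ _ _).trans (jointProb_le_of_explores h (i := j) ⟨hj, ?_⟩)
    rintro ⟨h1, h2⟩
    by_cases hji : j = i
    · subst hji
      exact lt_asymm h1 hlt
    · exact hj (h2.trans (hcj j hji))
  have hterm : ∀ e, jointProb κ U C ε b c e * f (c, e) ≤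
      (if e = c then q else 0) + (if e = b then N * ε else 0) + ε := by
    intro e
    have hq1 : 0 ≤ if e = c then q else 0 := by split_ifs <;> simp [hq0]
    have hq2 : 0 ≤ if e = b then N * ε else 0 := by split_ifs <;> positivity
    by_cases hec : e = c
    · have : jointProb κ U C ε b c e * f (c, e) ≤ if e = c then q else 0 := by
        rw [if_pos hec, hq, hec]
        split_ifs with hcS
        · rw [hf.eq_one c hcS, mul_one]
          exact hself
        · rw [hf.eq_zero c hcS, mul_zero]
      linarith
    by_cases hex : ∃ j, Explores U b c j (e j)
    · obtain ⟨j, hj⟩ := hex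
      have := (hf.jointProb_mul_le h b c (c, e)).trans (jointProb_le_of_explores h hj)
      linarith
    · push Not at hex
      have hstay : ∀ j, e j ≠ c j → U j c < U j b ∧ e j = b j := fun j hj => by
        by_contra h'
        exact hex j ⟨hj, h'⟩
      have hej : ∀ j, e j ≠ c j → j = i := fun j hj => by
        by_contra hji
        exact hj ((hstay j hj).2.trans (hcj j hji).symm)
      obtain ⟨j, hj⟩ := Function.ne_iff.1 hec
      obtain rfl := hej j hj
      have heb : e = b := by
        funext k
        by_cases hk : e k = c k
        · by_cases hkj : k = j
          · exact absurd (hkj ▸ hk) hj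
          · exact hk.trans (hcj k hkj)
        · exact (hstay k hk).2
      have := hback (hstay j hj).1
      have h2 : jointProb κ U C ε b c e * f (c, e) ≤ N * ε := by
        rw [heb]
        exact (mul_le_of_le_one_left (hf.nonneg _) (jointProb_le_one h _ _ _)).trans this
      rw [if_pos heb]
      linarith
  rw [hf.harmonic b c hcb.symm]
  refine (Finset.sum_le_sum fun e _ => hterm e).trans ?_
  rw [Finset.sum_add_distrib, Finset.sum_add_distrib, Finset.sum_ite_eq',
    if_pos (Finset.mem_univ _), Finset.sum_ite_eq', if_pos (Finset.mem_univ _), Finset.sum_const,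
    Finset.card_univ, nsmul_eq_mul]
  linarith

/-- Upper bound for entering `S` from outside, when some neighbour lies in `S`. -/
theorem sum_le_of_singleDev (hf : IsHitting κ U C ε S f) (h : Admissible C κ ε)
    (h3 : Assumption3 U C) (hpot : IsPotentialGame U C φ) (hb : b ∉ S) (ha : a ∈ S)
    (hba : SingleDev C b a) {Q : ℝ}
    (hQ : ∀ v ∈ S, SingleDev C b v → ε ^ (1 + max (φ b - φ v) 0) ≤ Q) :
    ∑ c, jointProb κ U C ε b b c * f (b, c) ≤
      Fintype.card (∀ i, A i) * ((1 + 2 * Fintype.card (∀ i, A i)) * Q) := by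
  have he := h.ε_pos
  have he1 : ε ≤ 1 := by linarith [h.ε_le]
  set N : ℝ := ((Fintype.card (∀ i, A i) : ℕ) : ℝ) with hN
  have hN0 : 0 ≤ N := Nat.cast_nonneg _
  have hQ2 : ε ^ 2 ≤ Q := by
    refine le_trans ?_ (hQ a ha hba)
    rw [← Real.rpow_natCast]
    refine Real.rpow_le_rpow_of_exponent_ge he he1 ?_
    have := abs_le.1 (hba.abs_sub_le h.constraints h3 hpot)
    have : max (φ b - φ a) 0 ≤ 1 / 2 := max_le this.2 (by norm_num)
    push_cast
    linarith
  have hQ0 : 0 ≤ Q := (sq_nonneg ε).trans hQ2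
  refine sum_jointProb_mul_le fun c => ?_
  by_cases hcb : c = b
  · rw [hcb, hf.eq_zero b hb, mul_zero]
    positivity
  by_cases h0 : jointProb κ U C ε b b c = 0
  · rw [h0, zero_mul]
    positivity
  have hpow := jointProb_le_pow (U := U) h b b c
  obtain ⟨i, hi⟩ := Function.ne_iff.1 hcb
  have hmem : i ∈ Finset.univ.filter fun i => c i ≠ b i := by simpa using hi
  have hpos : 0 < numExplorers U b b c := by
    rw [numExplorers_self]
    exact Finset.card_pos.2 ⟨i, hmem⟩
  by_cases hk : numExplorers U b b c = 1
  · rw [hk, pow_one] at hpow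
    have hex : Explores U b b i (c i) := ⟨hi, fun h' => lt_irrefl _ h'.1⟩
    have hdev : SingleDev C b c := by
      refine ⟨i, c i, mem_of_jointProb_ne_zero h0 hex, hi, ?_⟩
      rw [numExplorers_self] at hk
      obtain ⟨j, hj⟩ := Finset.card_eq_one.1 hk
      rw [hj, Finset.mem_singleton] at hmem
      subst hmem
      rw [Function.eq_update_iff]
      refine ⟨rfl, fun k hki => ?_⟩
      by_contra hck
      have : k ∈ Finset.univ.filter fun i => c i ≠ b i := by simpa using hck
      rw [hj, Finset.mem_singleton] at this
      exact hki this
    have hfle := hf.le_of_singleDev h hpot hb hdev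
    have hmain : ε * (if c ∈ S then ε ^ max (φ b - φ c) 0 else 0) ≤ Q := by
      split_ifs with hcS
      · rw [← Real.rpow_one_add' he.le (by positivity)]
        exact hQ c hcS hdev
      · rw [mul_zero]
        exact hQ0
    calc jointProb κ U C ε b b c * f (b, c)
        ≤ ε * ((if c ∈ S then ε ^ max (φ b - φ c) 0 else 0) + 2 * N * ε) :=
          mul_le_mul hpow hfle (hf.nonneg _) he.le
      _ ≤ (1 + 2 * N) * Q := by nlinarith
  · calc jointProb κ U C ε b b c * f (b, c) ≤ ε ^ numExplorers U b b c :=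
          (hf.jointProb_mul_le h _ _ _).trans hpow
      _ ≤ ε ^ 2 := pow_le_pow_of_le_one he.le he1 (by omega)
      _ ≤ Q := hQ2
      _ ≤ (1 + 2 * N) * Q := by nlinarith

/-- Upper bound for entering `S` from outside, through the barriers. -/
theorem sum_le_of_stateDist (hf : IsHitting κ U C ε S f) (h : Admissible C κ ε) {K : ℝ}
    (hK : 1 ≤ K) (hKK : 2 * Fintype.card (∀ i, A i) * (2 * Fintype.card ι + 1) ≤ K)
    (hKε : K * ε ≤ 1) {Q : ℝ} (b : ∀ i, A i) (hQ : ∀ s ∈ S, ε ^ stateDist C s b b ≤ Q)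
    {D : ℕ} (hD : ∀ s, stateDist C s b b ≤ D) (hQ0 : 0 ≤ Q) :
    ∑ c, jointProb κ U C ε b b c * f (b, c) ≤
      Fintype.card (∀ i, A i) * (Fintype.card (∀ i, A i) * (2 * K ^ D * Q)) := by
  have hle : ∀ z, f z ≤ ∑ s ∈ S, barrier U C K ε s z.1 z.2 := by
    refine hf.le_of_superharmonic _ (fun z => Finset.sum_nonneg fun s _ =>
      barrier_nonneg h hK _ _ _) (fun a ha => ?_) fun x y hxy => ?_
    · refine le_trans ?_ (Finset.single_le_sum (f := fun s => barrier U C K ε s a a)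
        (fun s _ => barrier_nonneg h hK _ _ _) ha)
      simpa [barrier, stateDist_self] using (barrier_factor_mem_Icc U a a).1
    · simp only [Finset.mul_sum]
      rw [Finset.sum_comm]
      exact Finset.sum_le_sum fun s _ => sum_jointProb_mul_barrier_le h hK hKK hKε s hxy
  refine sum_jointProb_mul_le fun c => ?_
  have hterm : ∀ s ∈ S, jointProb κ U C ε b b c * barrier U C K ε s b c ≤ 2 * K ^ D * Q := by
    intro s hs
    refine (jointProb_mul_barrier_le h hK hKε s b b c).trans ?_
    rw [mul_pow, mul_assoc]
    have h1 : K ^ stateDist C s b b ≤ K ^ D := pow_le_pow_right₀ hK (hD s)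
    have h2 := mul_le_mul h1 (hQ s hs) (pow_nonneg h.ε_pos.le _) (by positivity)
    linarith
  calc jointProb κ U C ε b b c * f (b, c)
      ≤ jointProb κ U C ε b b c * ∑ s ∈ S, barrier U C K ε s b c :=
        mul_le_mul_of_nonneg_left (hle _) (jointProb_nonneg h _ _ _)
    _ ≤ S.card • (2 * K ^ D * Q) := by
        rw [Finset.mul_sum]
        exact Finset.sum_le_card_nsmul _ _ _ hterm
    _ ≤ _ := by
        rw [nsmul_eq_mul]
        have : (S.card : ℝ) ≤ Fintype.card (∀ i, A i) := by exact_mod_cast Finset.card_le_univ S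
        gcongr

/-- Lower bound for leaving `S`. -/
theorem le_one_sub_sum (hf : IsHitting κ U C ε S f) (h : Admissible C κ ε)
    (hab : a ≠ b) (hb : b ∉ S) :
    jointProb κ U C ε a a b * jointProb κ U C ε a b b ≤
      1 - ∑ c, jointProb κ U C ε a a c * f (a, c) := by
  have key : ∀ (x y e : ∀ i, A i), jointProb κ U C ε x y e * (1 - f (y, e)) ≤
      1 - ∑ c, jointProb κ U C ε x y c * f (y, c) := by
    intro x y e
    have hsum : 1 - ∑ c, jointProb κ U C ε x y c * f (y, c) =
        ∑ c, jointProb κ U C ε x y c * (1 - f (y, c)) := by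
      simp only [mul_one_sub, Finset.sum_sub_distrib, sum_jointProb h]
    rw [hsum]
    exact Finset.single_le_sum (f := fun c => jointProb κ U C ε x y c * (1 - f (y, c)))
      (fun c _ => mul_nonneg (jointProb_nonneg h _ _ _) (sub_nonneg.2 (hf.le_one _)))
      (Finset.mem_univ e)
  refine le_trans (mul_le_mul_of_nonneg_left ?_ (jointProb_nonneg h _ _ _)) (key a a b)
  rw [hf.harmonic a b hab]
  simpa [hf.eq_zero b hb] using key a b b

/-- The flows in and out of `S` of a stationary distribution, observed on the diagonal, agree. -/
theorem flow_balance (hf : IsHitting κ U C ε S f) {π : (∀ i, A i) × (∀ i, A i) → ℝ}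
    (hπ : ∀ w, ∑ z, π z * phTrans κ U C ε z w = π w) :
    ∑ a ∈ S, π (a, a) * (1 - ∑ c, jointProb κ U C ε a a c * f (a, c)) =
      ∑ b ∈ Sᶜ, π (b, b) * ∑ c, jointProb κ U C ε b b c * f (b, c) := by
  have h1 : ∑ z, π z * (∑ w, phTrans κ U C ε z w * f w - f z) = 0 := by
    simp only [mul_sub, Finset.sum_sub_distrib, Finset.mul_sum, ← mul_assoc]
    rw [Finset.sum_comm]
    simp only [← Finset.sum_mul, hπ, sub_self]
  simp only [sum_phTrans_mul] at h1
  rw [Fintype.sum_prod_type] at h1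
  have h2 : ∀ a, ∑ y, π (a, y) * (∑ c, jointProb κ U C ε a y c * f (y, c) - f (a, y)) =
      π (a, a) * (∑ c, jointProb κ U C ε a a c * f (a, c) - f (a, a)) := by
    intro a
    refine Finset.sum_eq_single a (fun y _ hy => ?_) fun h' => absurd (Finset.mem_univ a) h'
    rw [hf.harmonic a y hy.symm, sub_self, mul_zero]
  simp only [h2] at h1
  rw [← Finset.sum_add_sum_compl S] at h1
  have h3 : ∑ a ∈ S, π (a, a) * (∑ c, jointProb κ U C ε a a c * f (a, c) - f (a, a)) =
      - ∑ a ∈ S, π (a, a) * (1 - ∑ c, jointProb κ U C ε a a c * f (a, c)) := by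
    rw [← Finset.sum_neg_distrib]
    refine Finset.sum_congr rfl fun a ha => ?_
    rw [hf.eq_one a ha]
    ring
  have h4 : ∑ b ∈ Sᶜ, π (b, b) * (∑ c, jointProb κ U C ε b b c * f (b, c) - f (b, b)) =
      ∑ b ∈ Sᶜ, π (b, b) * ∑ c, jointProb κ U C ε b b c * f (b, c) := by
    refine Finset.sum_congr rfl fun b hb => ?_
    rw [hf.eq_zero b (Finset.mem_compl.1 hb), sub_zero]
  linarith

end IsHitting

theorem rpow_one_add_max (h : Admissible C κ ε) (r t : ℝ) :
    ε ^ (1 + max (r - t) 0) = ε ^ r * ε ^ (1 - min r t) := by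
  rw [← Real.rpow_add h.ε_pos]
  congr 1
  rcases le_total r t with hrt | hrt
  · rw [max_eq_right (by linarith), min_eq_left hrt]
    ring
  · rw [max_eq_left (by linarith), min_eq_right hrt]
    ring

namespace IsHitting

variable {S : Finset (∀ i, A i)} {f : (∀ i, A i) × (∀ i, A i) → ℝ}

/-- The probability of entering `S` is controlled by the cheapest crossing into `S`. -/
theorem sum_le_of_crossing (hf : IsHitting κ U C ε S f) (h : Admissible C κ ε)
    (h3 : Assumption3 U C) (hpot : IsPotentialGame U C φ) (hS : S.Nonempty) (hb : b ∉ S) {K : ℝ}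
    (hK : 1 ≤ K) (hKK : 2 * Fintype.card (∀ i, A i) * (2 * Fintype.card ι + 1) ≤ K)
    (hKε : K * ε ≤ 1) {D : ℕ} (hD : ∀ s, stateDist C s b b ≤ D) {M : ℝ}
    (hM : ∀ u ∉ S, ∀ v ∈ S, SingleDev C u v → ε ^ (1 - min (φ u) (φ v)) ≤ M) :
    ∑ c, jointProb κ U C ε b b c * f (b, c) ≤
      (Fintype.card (∀ i, A i) * (1 + 2 * Fintype.card (∀ i, A i)) +
        Fintype.card (∀ i, A i) * (Fintype.card (∀ i, A i) * (2 * K ^ D))) * (ε ^ φ b * M) := by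
  have he := h.ε_pos
  have hcross : ∀ s ∈ S, _ := fun s hs => exists_singleDev_crossing h.constraints
    (fun _ _ hd => hd.abs_sub_le h.constraints h3 hpot) S hs hb
  have hQ0 : 0 ≤ ε ^ φ b * M := by
    obtain ⟨s, hs⟩ := hS
    obtain ⟨u, hu, v, hv, huv, -⟩ := hcross s hs
    exact mul_nonneg (Real.rpow_nonneg he.le _) ((Real.rpow_nonneg he.le _).trans (hM u hu v hv huv))
  rw [add_mul]
  by_cases hnb : ∃ v ∈ S, SingleDev C b v
  · obtain ⟨v, hv, hbv⟩ := hnb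
    refine (hf.sum_le_of_singleDev h h3 hpot hb hv hbv (Q := ε ^ φ b * M)
      fun w hw hbw => ?_).trans ?_
    · rw [rpow_one_add_max h]
      exact mul_le_mul_of_nonneg_left (hM b hb w hw hbw) (Real.rpow_nonneg he.le _)
    · rw [mul_assoc]
      exact le_add_of_nonneg_right (by positivity)
  · refine (hf.sum_le_of_stateDist h hK hKK hKε b (Q := ε ^ φ b * M) (fun s hs => ?_) hD
      hQ0).trans ?_
    · obtain ⟨u, hu, v, hv, huv, hle, -, h2 | rfl⟩ := hcross s hs
      · have h2' : (2 : ℝ) ≤ stateDist C s b b := by exact_mod_cast h2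
        calc ε ^ stateDist C s b b = ε ^ (stateDist C s b b : ℝ) := (Real.rpow_natCast _ _).symm
          _ ≤ ε ^ (φ b + (1 - min (φ u) (φ v))) :=
            Real.rpow_le_rpow_of_exponent_ge he (by linarith [h.ε_le]) (by linarith)
          _ = ε ^ φ b * ε ^ (1 - min (φ u) (φ v)) := Real.rpow_add he _ _
          _ ≤ ε ^ φ b * M :=
            mul_le_mul_of_nonneg_left (hM u hu v hv huv) (Real.rpow_nonneg he.le _)
      · exact absurd ⟨v, hv, huv⟩ hnb
    · simp only [mul_assoc]
      exact le_add_of_nonneg_left (by positivity)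

theorem le_one_sub_sum_of_singleDev (hf : IsHitting κ U C ε S f) (h : Admissible C κ ε)
    (hpot : IsPotentialGame U C φ) (hab : SingleDev C a b) (hb : b ∉ S) :
    κ / 2 * ((1 / 2) ^ Fintype.card ι) ^ 2 / (∑ i, Fintype.card (A i) + 1) *
      (ε ^ φ a * ε ^ (1 - min (φ a) (φ b))) ≤
      1 - ∑ c, jointProb κ U C ε a a c * f (a, c) := by
  have he := h.ε_pos
  have hk := h.κ_pos
  have hne : a ≠ b := by
    obtain ⟨i, u, -, hu, rfl⟩ := hab
    exact fun h' => hu (by rw [h', Function.update_self])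
  refine le_trans ?_ (hf.le_one_sub_sum h hne hb)
  refine le_trans (le_of_eq ?_) (mul_le_mul (hab.le_jointProb_explore h)
    (hab.le_jointProb_settle h hpot) (by positivity) (jointProb_nonneg h _ _ _))
  rw [← rpow_one_add_max h, Real.rpow_add he, Real.rpow_one]
  ring

end IsHitting

/-- A stationary distribution weighted by `ε ^ φ` is balanced across every cut, up to constants
independent of `ε`. -/
theorem exists_cut_le (h : Admissible C κ ε) (h3 : Assumption3 U C)
    (hpot : IsPotentialGame U C φ) {π : (∀ i, A i) × (∀ i, A i) → ℝ} (hπ0 : ∀ z, 0 ≤ π z)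
    (hπ : ∀ w, ∑ z, π z * phTrans κ U C ε z w = π w) {K : ℝ}
    (hK : 1 ≤ K) (hKK : 2 * Fintype.card (∀ i, A i) * (2 * Fintype.card ι + 1) ≤ K)
    (hKε : K * ε ≤ 1) {D : ℕ} (hD : ∀ s b, stateDist C s b b ≤ D) (S : Finset (∀ i, A i))
    (hS : S.Nonempty) (hSc : Sᶜ.Nonempty) :
    ∃ a ∈ S, ∃ b ∉ S,
      κ / 2 * ((1 / 2) ^ Fintype.card ι) ^ 2 / (∑ i, Fintype.card (A i) + 1) *
        (π (a, a) * ε ^ φ a) ≤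
      Fintype.card (∀ i, A i) * (Fintype.card (∀ i, A i) * (1 + 2 * Fintype.card (∀ i, A i)) +
        Fintype.card (∀ i, A i) * (Fintype.card (∀ i, A i) * (2 * K ^ D))) *
        (π (b, b) * ε ^ φ b) := by
  have he := h.ε_pos
  have hk := h.κ_pos
  obtain ⟨f, hf⟩ := exists_isHitting (U := U) h S
  set c₀ : ℝ := κ / 2 * ((1 / 2) ^ Fintype.card ι) ^ 2 / (∑ i, Fintype.card (A i) + 1) with hc₀
  set c₁ : ℝ := Fintype.card (∀ i, A i) * (1 + 2 * Fintype.card (∀ i, A i)) +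
        Fintype.card (∀ i, A i) * (Fintype.card (∀ i, A i) * (2 * K ^ D)) with hc₁
  have hc₁0 : 0 ≤ c₁ := by positivity
  obtain ⟨s, hs⟩ := hS
  obtain ⟨t, ht⟩ := hSc
  obtain ⟨u₀, hu₀, v₀, hv₀, huv₀, -⟩ := exists_singleDev_crossing h.constraints
    (fun _ _ hd => hd.abs_sub_le h.constraints h3 hpot) S hs (Finset.mem_compl.1 ht)
  obtain ⟨⟨u, v⟩, huv, hmax⟩ := Finset.exists_max_image
    (Finset.univ.filter fun q : (∀ i, A i) × (∀ i, A i) =>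
      q.1 ∉ S ∧ q.2 ∈ S ∧ SingleDev C q.1 q.2)
    (fun q => ε ^ (1 - min (φ q.1) (φ q.2))) ⟨(u₀, v₀), by simp [hu₀, hv₀, huv₀]⟩
  obtain ⟨hu, hv, hdev⟩ : u ∉ S ∧ v ∈ S ∧ SingleDev C u v := by simpa using huv
  set M : ℝ := ε ^ (1 - min (φ u) (φ v)) with hM
  have hM0 : 0 < M := Real.rpow_pos_of_pos he _
  have hM' : ∀ u ∉ S, ∀ v ∈ S, SingleDev C u v → ε ^ (1 - min (φ u) (φ v)) ≤ M :=
    fun u' hu' v' hv' hd' => hmax (u', v') (by simp [hu', hv', hd'])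
  obtain ⟨b, hb, hbmax⟩ := Finset.exists_max_image Sᶜ (fun b => π (b, b) * ε ^ φ b) ⟨t, ht⟩
  refine ⟨v, hv, b, Finset.mem_compl.1 hb, ?_⟩
  have hρ0 : ∀ a, 0 ≤ π (a, a) * ε ^ φ a := fun a =>
    mul_nonneg (hπ0 _) (Real.rpow_nonneg he.le _)
  have hlow : c₀ * (π (v, v) * ε ^ φ v) * M ≤
      ∑ a ∈ S, π (a, a) * (1 - ∑ c, jointProb κ U C ε a a c * f (a, c)) := by
    refine le_trans ?_ (Finset.single_le_sum (f := fun a => π (a, a) *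
      (1 - ∑ c, jointProb κ U C ε a a c * f (a, c))) (fun a _ => mul_nonneg (hπ0 _) ?_) hv)
    · have := mul_le_mul_of_nonneg_left
        (hf.le_one_sub_sum_of_singleDev h hpot (hdev.symm h.constraints) hu) (hπ0 (v, v))
      rw [min_comm, ← hM] at this
      refine le_trans (le_of_eq ?_) this
      ring
    · rw [sub_nonneg, ← sum_jointProb (U := U) h a a]
      exact Finset.sum_le_sum fun c _ => hf.jointProb_mul_le h a a (a, c)
  have hup : ∑ b ∈ Sᶜ, π (b, b) * ∑ c, jointProb κ U C ε b b c * f (b, c) ≤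
      Fintype.card (∀ i, A i) * c₁ * (π (b, b) * ε ^ φ b) * M := by
    have hterm : ∀ b' ∈ Sᶜ, π (b', b') * ∑ c, jointProb κ U C ε b' b' c * f (b', c) ≤
        c₁ * (π (b, b) * ε ^ φ b) * M := by
      intro b' hb'
      have h1 := hf.sum_le_of_crossing h h3 hpot ⟨s, hs⟩ (Finset.mem_compl.1 hb') hK hKK hKε
        (fun s => hD s b') hM'
      calc _ ≤ π (b', b') * (c₁ * (ε ^ φ b' * M)) := mul_le_mul_of_nonneg_left h1 (hπ0 _)
        _ = c₁ * M * (π (b', b') * ε ^ φ b') := by ring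
        _ ≤ c₁ * M * (π (b, b) * ε ^ φ b) :=
          mul_le_mul_of_nonneg_left (hbmax b' hb') (by positivity)
        _ = _ := by ring
    refine (Finset.sum_le_card_nsmul _ _ _ hterm).trans ?_
    have hcard : ((Sᶜ).card : ℝ) ≤ Fintype.card (∀ i, A i) := by
      exact_mod_cast Finset.card_le_univ Sᶜ
    have := mul_le_mul_of_nonneg_right hcard
      (mul_nonneg (mul_nonneg hc₁0 (hρ0 b)) hM0.le)
    rw [nsmul_eq_mul]
    refine this.trans (le_of_eq ?_)
    ring
  exact le_of_mul_le_mul_right ((hlow.trans_eq (hf.flow_balance hπ)).trans hup) hM0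

/-- The stationary distributions of `{P^ε}` are comparable to `ε ^ (-φ)` on the diagonal. -/
theorem exists_stationary_ratio_le (hκ0 : 0 < κ) (hκ : κ ≤ 1 / 2) (h1 : Assumption1 C)
    (h3 : Assumption3 U C) (hpot : IsPotentialGame U C φ) :
    ∃ R : ℝ, 0 ≤ R ∧ ∃ ε₀ > 0, ∀ ε, 0 < ε → ε ≤ ε₀ → ε ≤ 1 / 2 →
      ∀ π : (∀ i, A i) × (∀ i, A i) → ℝ, (∀ z, 0 ≤ π z) →
      (∀ w, ∑ z, π z * phTrans κ U C ε z w = π w) →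
      ∀ x y, π (x, x) * ε ^ φ x ≤ R * (π (y, y) * ε ^ φ y) := by
  set K : ℝ := 1 + 2 * Fintype.card (∀ i, A i) * (2 * Fintype.card ι + 1) with hK
  have hK1 : 1 ≤ K := le_add_of_nonneg_right (by positivity)
  obtain ⟨D, hD⟩ : ∃ D, ∀ s b, stateDist C s b b ≤ D := by
    refine ⟨∑ s, ∑ b, stateDist C s b b, fun s b => ?_⟩
    exact (Finset.single_le_sum (f := fun b => stateDist C s b b) (fun _ _ => Nat.zero_le _)
      (Finset.mem_univ b)).trans (Finset.single_le_sum (f := fun s => ∑ b, stateDist C s b b)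
        (fun _ _ => Nat.zero_le _) (Finset.mem_univ s))
  set c₀ : ℝ := κ / 2 * ((1 / 2) ^ Fintype.card ι) ^ 2 / (∑ i, Fintype.card (A i) + 1) with hc₀
  have hc₀0 : 0 < c₀ := by positivity
  set c₁ : ℝ := Fintype.card (∀ i, A i) *
    (Fintype.card (∀ i, A i) * (1 + 2 * Fintype.card (∀ i, A i)) +
      Fintype.card (∀ i, A i) * (Fintype.card (∀ i, A i) * (2 * K ^ D))) with hc₁
  have hc₁0 : 0 ≤ c₁ := by positivity
  refine ⟨(1 + c₁ / c₀) ^ Fintype.card (∀ i, A i), by positivity, 1 / K, by positivity,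
    fun ε he hεK hε π hπ0 hπ => ?_⟩
  have h : Admissible C κ ε := ⟨he, hε, hκ0, hκ, h1⟩
  have hKε : K * ε ≤ 1 := by
    rw [mul_comm]
    exact (le_div_iff₀ (by positivity)).1 hεK
  have hρ0 : ∀ a, 0 ≤ π (a, a) * ε ^ φ a := fun a =>
    mul_nonneg (hπ0 _) (Real.rpow_nonneg he.le _)
  refine le_pow_card_mul_of_cuts (fun a => π (a, a) * ε ^ φ a) (1 + c₁ / c₀)
    (le_add_of_nonneg_right (by positivity)) hρ0 fun S hS hSu => ?_
  obtain ⟨a, ha, b, hb, hab⟩ := exists_cut_le h h3 hpot hπ0 hπ hK1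
    (by rw [hK]; linarith) hKε hD Sᶜ
    (by rwa [Finset.nonempty_iff_ne_empty, Ne, Finset.compl_eq_empty_iff])
    (by rwa [compl_compl])
  refine ⟨a, Finset.mem_compl.1 ha, b, by simpa using hb, ?_⟩
  have hab' : π (a, a) * ε ^ φ a ≤ c₁ / c₀ * (π (b, b) * ε ^ φ b) := by
    rw [div_mul_eq_mul_div, le_div_iff₀ hc₀0, mul_comm]
    exact hab
  have := hρ0 b
  linarith

/-- A stationary distribution charges the states off the diagonal at most linearly in `ε`. -/
theorem sum_offDiag_le (h : Admissible C κ ε) {π : (∀ i, A i) × (∀ i, A i) → ℝ}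
    (hπ0 : ∀ z, 0 ≤ π z) (hπ1 : ∑ z, π z = 1)
    (hπ : ∀ w, ∑ z, π z * phTrans κ U C ε z w = π w) :
    ∑ z, (if z.1 ≠ z.2 then π z else 0) ≤
      Fintype.card (∀ i, A i) * (2 * Fintype.card ι + 1) * ε := by
  have he := h.ε_pos
  set B : ℝ := Fintype.card (∀ i, A i) * (2 * Fintype.card ι + 1) * ε with hB
  have hdrift : ∀ x y, (if x ≠ y then (1 : ℝ) else 0) + ∑ c, jointProb κ U C ε x y c *
      settleLevel U y c ≤ settleLevel U x y + B := by
    intro x y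
    set d : ℝ := if x ≠ y then (1 : ℝ) else 0 with hd
    have hd1 : d ≤ settleLevel U x y := by
      rw [hd]
      split_ifs with hxy
      · have : 1 ≤ settleLevel U x y := by
          have := settleLevel_lt (U := U) (c := fun i => if U i y < U i x then x i else y i) hxy
            fun i => by
              unfold Explores
              split_ifs <;> simp_all
          omega
        exact_mod_cast this
      · exact Nat.cast_nonneg _
    have hterm : ∀ c, jointProb κ U C ε x y c * settleLevel U y c ≤
        jointProb κ U C ε x y c * (settleLevel U x y - d) + (2 * Fintype.card ι + 1) * ε := by
      intro c
      have hj := jointProb_nonneg (U := U) h x y c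
      by_cases hex : ∃ i, Explores U x y i (c i)
      · obtain ⟨i, hi⟩ := hex
        have h1 := jointProb_le_of_explores h hi
        have h2 : (settleLevel U y c : ℝ) ≤ 2 * Fintype.card ι + 1 := by
          exact_mod_cast settleLevel_le U y c
        have h3 := mul_le_mul h1 h2 (Nat.cast_nonneg _) he.le
        have h4 := mul_nonneg hj (sub_nonneg.2 hd1)
        linarith
      · push Not at hex
        have hle : (settleLevel U y c : ℝ) ≤ settleLevel U x y - d := by
          rw [hd]
          split_ifs with hxy
          · have := settleLevel_lt hxy hex
            have : (settleLevel U y c : ℝ) + 1 ≤ settleLevel U x y := by exact_mod_cast this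
            linarith
          · obtain rfl : x = y := by simpa using hxy
            have hc : c = x := by
              funext i
              have := hex i
              simp only [Explores, lt_irrefl, false_and, not_false_eq_true, and_true, not_not] at this
              exact this
            rw [hc, sub_zero]
        have h1 := mul_le_mul_of_nonneg_left hle hj
        have : 0 ≤ (2 * Fintype.card ι + 1) * ε := by positivity
        linarith
    have h1 := Finset.sum_le_sum fun c (_ : c ∈ Finset.univ) => hterm c
    rw [Finset.sum_add_distrib, ← Finset.sum_mul, sum_jointProb h, one_mul, Finset.sum_const,
      Finset.card_univ, nsmul_eq_mul] at h1
    rw [hB]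
    linarith
  have hstat : ∑ z, π z * ∑ c, jointProb κ U C ε z.1 z.2 c * (settleLevel U z.2 c : ℝ) =
      ∑ z, π z * settleLevel U z.1 z.2 := by
    have : ∀ z : (∀ i, A i) × (∀ i, A i),
        ∑ c, jointProb κ U C ε z.1 z.2 c * (settleLevel U z.2 c : ℝ) =
        ∑ w, phTrans κ U C ε z w * (settleLevel U w.1 w.2 : ℝ) := fun z =>
      (sum_phTrans_mul (fun w => (settleLevel U w.1 w.2 : ℝ)) z).symm
    simp only [this, Finset.mul_sum, ← mul_assoc]
    rw [Finset.sum_comm]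
    simp only [← Finset.sum_mul, hπ]
  have hsum := Finset.sum_le_sum fun z (_ : z ∈ Finset.univ) =>
    mul_le_mul_of_nonneg_left (hdrift z.1 z.2) (hπ0 z)
  simp only [mul_add, Finset.sum_add_distrib, ← Finset.sum_mul, hπ1, mul_ite, mul_one,
    mul_zero] at hsum
  rw [hstat] at hsum
  linarith

theorem phTrans_eq_jointProb (x y c : ∀ i, A i) :
    phTrans κ U C ε (x, y) (y, c) = jointProb κ U C ε x y c := by
  simp [phTrans, jointProb]

theorem phTransPow_eq_pow (k : ℕ) :
    ∀ z w, phTransPow κ U C ε k z w = ((Matrix.of (phTrans κ U C ε)) ^ k) z w := by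
  induction k with
  | zero =>
    intro z w
    rw [phTransPow, pow_zero, Matrix.one_apply]
  | succ k ih =>
    intro z w
    rw [phTransPow, pow_succ', Matrix.mul_apply]
    exact Finset.sum_congr rfl fun v _ => by rw [ih, Matrix.of_apply]

theorem phTrans_mem_rowStochastic (h : Admissible C κ ε) :
    Matrix.of (phTrans κ U C ε) ∈
      Matrix.rowStochastic ℝ ((∀ i, A i) × (∀ i, A i)) := by
  rw [Matrix.mem_rowStochastic_iff_sum]
  exact ⟨fun z w => phTrans_nonneg h z w, fun z => sum_phTrans h z⟩

theorem jointProb_settle_pos (h : Admissible C κ ε) (x y : ∀ i, A i) :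
    0 < jointProb κ U C ε x y y := by
  have he := h.ε_pos
  have he' := h.ε_le
  have hk := h.κ_pos
  have hk' := h.κ_le
  refine Finset.prod_pos fun i _ => ?_
  by_cases hxy : x i = y i
  · rw [selProb_stay_of_eq hxy]
    linarith
  rcases le_or_gt (U i x) (U i y) with hle | hlt
  · rw [selProb_stay_of_le hle]
    linarith
  · rw [selProb_stay_of_lt hlt hxy]
    have : 0 < 1 - ε := by linarith
    positivity

theorem exists_pow_pos_trans {Z : Type*} [Fintype Z] [DecidableEq Z] {P : Matrix Z Z ℝ}
    (hP : P ∈ Matrix.rowStochastic ℝ Z) {x y z : Z} (hxy : ∃ k, 0 < (P ^ k) x y)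
    (hyz : ∃ k, 0 < (P ^ k) y z) : ∃ k, 0 < (P ^ k) x z := by
  obtain ⟨k, hk⟩ := hxy
  obtain ⟨l, hl⟩ := hyz
  refine ⟨k + l, ?_⟩
  rw [pow_add, Matrix.mul_apply]
  have hnn := fun m => (Matrix.mem_rowStochastic.1 (pow_mem hP m)).1
  exact (mul_pos hk hl).trans_le (Finset.single_le_sum (f := fun w => (P ^ k) x w * (P ^ l) w z)
    (fun w _ => mul_nonneg (hnn _ _ _) (hnn _ _ _)) (Finset.mem_univ y))

theorem exists_pow_phTrans_pos (h : Admissible C κ ε) (s : ∀ i, A i)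
    (z : (∀ i, A i) × (∀ i, A i)) :
    ∃ k, 0 < ((Matrix.of (phTrans κ U C ε)) ^ k) z (s, s) := by
  have hP := phTrans_mem_rowStochastic (U := U) h
  have hstep : ∀ {x y c}, 0 < jointProb κ U C ε x y c →
      ∃ k, 0 < ((Matrix.of (phTrans κ U C ε)) ^ k) (x, y) (y, c) := fun hc =>
    ⟨1, by rwa [pow_one, Matrix.of_apply, phTrans_eq_jointProb]⟩
  have hdiag : ∀ b, ∃ k, 0 < ((Matrix.of (phTrans κ U C ε)) ^ k) (b, b) (s, s) := by
    intro b
    induction hd : stateDist C s b b using Nat.strong_induction_on generalizing b with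
    | _ d ih =>
    by_cases hbs : b = s
    · rw [hbs]
      exact hstep (jointProb_settle_pos h s s)
    obtain ⟨b', hdev, hlt⟩ := exists_singleDev_stateDist h.constraints hbs
    have he := h.ε_pos
    have hexp : 0 < jointProb κ U C ε b b b' :=
      lt_of_lt_of_le (by positivity) (hdev.le_jointProb_explore h)
    exact exists_pow_pos_trans hP (hstep hexp) (exists_pow_pos_trans hP
      (hstep (jointProb_settle_pos h b b')) (ih _ (by omega) b' rfl))
  exact exists_pow_pos_trans hP (hstep (jointProb_settle_pos h z.1 z.2)) (hdiag z.2)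

theorem exists_stationary (h : Admissible C κ ε) (s : ∀ i, A i) :
    ∃ π : (∀ i, A i) × (∀ i, A i) → ℝ, (∀ z, 0 ≤ π z) ∧ ∑ z, π z = 1 ∧
      (∀ w, ∑ z, π z * phTrans κ U C ε z w = π w) ∧
      ∀ z w, Tendsto (fun k => phTransPow κ U C ε k z w) atTop (𝓝 (π w)) := by
  simp only [phTransPow_eq_pow]
  refine exists_stationary_tendsto_pow (Matrix.of (phTrans κ U C ε))
    (phTrans_mem_rowStochastic h) (s, s) (exists_pow_phTrans_pos h s) ?_
  rw [Matrix.of_apply, phTrans_eq_jointProb]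
  exact jointProb_settle_pos h s s

/-- As `ε → 0`, the stationary distributions concentrate on the maximizers of the potential. -/
theorem exists_stationary_maximizers_gt [∀ i, Nonempty (A i)] (hκ0 : 0 < κ) (hκ : κ ≤ 1 / 2)
    (h1 : Assumption1 C) (h3 : Assumption3 U C) (hpot : IsPotentialGame U C φ) {p : ℝ}
    (hp : p < 1) :
    ∃ ε₀ > 0, ∀ ε, 0 < ε → ε ≤ ε₀ → ε ≤ 1 / 2 →
      ∀ π : (∀ i, A i) × (∀ i, A i) → ℝ, (∀ z, 0 ≤ π z) → ∑ z, π z = 1 →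
      (∀ w, ∑ z, π z * phTrans κ U C ε z w = π w) →
      p < ∑ z, (if ∀ b, φ b ≤ φ z.2 then π z else 0) := by
  obtain ⟨R, hR, ε₀, hε₀, hratio⟩ := exists_stationary_ratio_le (U := U) hκ0 hκ h1 h3 hpot
  obtain ⟨m, hm⟩ := Finite.exists_max φ
  set bad : ℝ → ℝ := fun ε => Fintype.card (∀ i, A i) * (2 * Fintype.card ι + 1) * ε +
    ∑ b, (if φ b < φ m then R * ε ^ (φ m - φ b) else 0) with hbad
  have hlim : Tendsto bad (𝓝[>] 0) (𝓝 0) := by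
    have hid : Tendsto (fun ε : ℝ => ε) (𝓝[>] 0) (𝓝 0) := tendsto_id.mono_left nhdsWithin_le_nhds
    have hb : ∀ b, Tendsto (fun ε : ℝ => if φ b < φ m then R * ε ^ (φ m - φ b) else 0)
        (𝓝[>] 0) (𝓝 0) := by
      intro b
      split_ifs with hbm
      · have := (hid.rpow_const (p := φ m - φ b) (Or.inr (by linarith))).const_mul R
        rwa [Real.zero_rpow (by linarith), mul_zero] at this
      · exact tendsto_const_nhds
    have := (hid.const_mul (Fintype.card (∀ i, A i) * (2 * Fintype.card ι + 1) : ℝ)).add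
      (tendsto_finsetSum Finset.univ fun b _ => hb b)
    simpa only [mul_zero, Finset.sum_const_zero, add_zero] using this
  obtain ⟨ε₁, hε₁, hsmall⟩ := mem_nhdsGT_iff_exists_Ioc_subset.1
    (hlim.eventually_lt_const (sub_pos.2 hp))
  refine ⟨min ε₀ ε₁, lt_min hε₀ hε₁, fun ε he hle hε π hπ0 hπ1 hπ => ?_⟩
  have h : Admissible C κ ε := ⟨he, hε, hκ0, hκ, h1⟩
  have hlt : bad ε < 1 - p := hsmall ⟨he, hle.trans (min_le_right _ _)⟩
  have hle1 : ∀ z, π z ≤ 1 := fun z =>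
    hπ1 ▸ Finset.single_le_sum (fun z _ => hπ0 z) (Finset.mem_univ z)
  have hdiag : ∀ b, φ b < φ m → π (b, b) ≤ R * ε ^ (φ m - φ b) := by
    intro b _
    have h2 := hratio ε he (hle.trans (min_le_left _ _)) hε π hπ0 hπ b m
    rw [Real.rpow_sub he, ← mul_div_assoc, le_div_iff₀ (Real.rpow_pos_of_pos he _)]
    refine h2.trans (mul_le_mul_of_nonneg_left ?_ hR)
    exact mul_le_of_le_one_left (Real.rpow_nonneg he.le _) (hle1 _)
  have hcover : ∀ z : (∀ i, A i) × (∀ i, A i), π z ≤ (if ∀ b, φ b ≤ φ z.2 then π z else 0) +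
      ((if z.1 ≠ z.2 then π z else 0) +
        if z.1 = z.2 then (if φ z.2 < φ m then R * ε ^ (φ m - φ z.2) else 0) else 0) := by
    rintro ⟨x, y⟩
    have := hπ0 (x, y)
    by_cases hxy : x = y
    · subst hxy
      by_cases hx : φ x < φ m
      · have h1 := hdiag x hx
        simp only [if_pos hx, ne_eq, not_true_eq_false, if_false, if_true]
        split_ifs <;> linarith
      · have : ∀ b, φ b ≤ φ x := fun b => (hm b).trans (not_lt.1 hx)
        simp [this, hx]
    · simp only [ne_eq, hxy, not_false_eq_true, if_true, if_false]
      split_ifs <;> linarith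
  have hsum := Finset.sum_le_sum fun z (_ : z ∈ Finset.univ) => hcover z
  rw [hπ1, Finset.sum_add_distrib, Finset.sum_add_distrib] at hsum
  have hoff := sum_offDiag_le h hπ0 hπ1 hπ
  have hon : ∑ z : (∀ i, A i) × (∀ i, A i),
      (if z.1 = z.2 then (if φ z.2 < φ m then R * ε ^ (φ m - φ z.2) else 0) else 0) =
      ∑ b, (if φ b < φ m then R * ε ^ (φ m - φ b) else 0) := by
    rw [Fintype.sum_prod_type]
    refine Finset.sum_congr rfl fun b _ => ?_
    rw [Finset.sum_eq_single b (fun c _ hc => if_neg hc.symm) fun h' =>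
      absurd (Finset.mem_univ b) h']
    exact if_pos rfl
  rw [hon] at hsum
  simp only [hbad] at hlt
  linarith

end Game

section Theorems

variable {ι : Type*} [Fintype ι] [DecidableEq ι] {A : ι → Type*} [∀ i, Fintype (A i)]

theorem statement2 [∀ i, Nonempty (A i)]
    (U : ι → (∀ i, A i) → ℝ) (C : ∀ i, A i → Finset (A i)) (φ : (∀ i, A i) → ℝ)
    (κ : ℝ) (hκ0 : 0 < κ) (hκ : κ ≤ 1 / 2)
    (hA1 : Assumption1 C) (hA3 : Assumption3 U C) (hpot : IsPotentialGame U C φ)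
    (p : ℝ) (hp : p < 1) :
    ∃ εstar : ℝ, 0 < εstar ∧ ∀ ε : ℝ, 0 < ε → ε ≤ εstar → ε ≤ 1 / 2 →
      ∃ K : ℕ, ∀ k : ℕ, K ≤ k → ∀ z0 : (∀ i, A i) × (∀ i, A i), memB C z0 →
        p < ∑ z' : (∀ i, A i) × (∀ i, A i),
          (if ∀ b, φ b ≤ φ z'.2 then phTransPow κ U C ε k z0 z' else 0) := by
  obtain ⟨εstar, hpos, hstar⟩ := exists_stationary_maximizers_gt hκ0 hκ hA1 hA3 hpot hp
  refine ⟨εstar, hpos, fun ε he hle hε => ?_⟩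
  have s : ∀ i, A i := fun i => Classical.arbitrary _
  obtain ⟨π, hπ0, hπ1, hπ, hlim⟩ := exists_stationary (U := U) ⟨he, hε, hκ0, hκ, hA1⟩ s
  have hev : ∀ z0 : (∀ i, A i) × (∀ i, A i), ∀ᶠ k in atTop,
      p < ∑ z' : (∀ i, A i) × (∀ i, A i),
        (if ∀ b, φ b ≤ φ z'.2 then phTransPow κ U C ε k z0 z' else 0) := by
    intro z0
    refine Tendsto.eventually_const_lt (hstar ε he hle hε π hπ0 hπ1 hπ)
      (tendsto_finsetSum _ fun z' _ => ?_)
    split_ifs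
    · exact hlim z0 z'
    · exact tendsto_const_nhds
  obtain ⟨K, hK⟩ := eventually_atTop.1 (eventually_all.2 hev)
  exact ⟨K, fun k hk z0 _ => hK k hk z0⟩

end Theorems
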